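/- arXiv:1508.06703 — 3 statements merged into one kernel-verified Lean document; each statement's English description precedes it below -/
import Mathlib

section
/- There exist r > 0 and ε > 0, independent of s, such that for every s ∈ S there are functions A_s, holomorphic on the open ball D'(0,ε) ⊂ ℂ^{d−1}, and B_s, holomorphic on B(0,r) × D'(0,ε) ⊂ ℂ × ℂ^{d−1}, with A_s(0) = 0, B_s nowhere vanishing on B(0,r) × D'(0,ε), and W(s, (z₁, z')) = (z₁ − A_s(z')) B_s(z₁, z') for all (z₁, z') ∈ B(0,r) × D'(0,ε); moreover the maps (s, z') ↦ A_s(z') and (s, z) ↦ B_s(z) are jointly continuous, together with all their derivatives in the complex variables. -/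
open Metric Set

section helpers
open Filter Topology

theorem wp_unif {X Y G : Type*} [TopologicalSpace X] [TopologicalSpace Y]
    [NormedAddCommGroup G] {f : X → Y → G} {x₀ : X} {K : Set Y} (hK : IsCompact K)
    (hf : ∀ y ∈ K, ContinuousAt (fun p : X × Y => f p.1 p.2) (x₀, y)) {δ : ℝ} (hδ : 0 < δ) :
    ∀ᶠ x in 𝓝 x₀, ∀ y ∈ K, ‖f x y - f x₀ y‖ < δ := by
  refine hK.eventually_forall_of_forall_eventually (P := fun x y => ‖f x y - f x₀ y‖ < δ) ?_
  intro y hy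
  have h1 := hf y hy
  have h2 : ContinuousAt (fun p : X × Y => f x₀ p.2) (x₀, y) :=
    ContinuousAt.comp (f := fun p : X × Y => (x₀, p.2)) (g := fun p : X × Y => f p.1 p.2)
      (hf y hy) (by fun_prop)
  have h3 := (h1.sub h2).norm
  have : ‖f x₀ y - f x₀ y‖ < δ := by simpa using hδ
  exact h3.eventually_lt_const this

theorem wp_cont_integral {X G : Type*} [TopologicalSpace X]
    [NormedAddCommGroup G] [NormedSpace ℝ G] {f : X → ℝ → G} {s : Set X}
    (hf : ContinuousOn (fun p : X × ℝ => f p.1 p.2) (s ×ˢ univ)) (a b : ℝ) :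
    ContinuousOn (fun x => ∫ t in a..b, f x t) s := by
  rw [continuousOn_iff_continuous_domRestrict]
  have hg : Continuous (fun p : s × ℝ => f p.1 p.2) :=
    hf.comp_continuous (f := fun p : s × ℝ => ((p.1 : X), p.2)) (by fun_prop)
      (fun p => ⟨p.1.2, mem_univ _⟩)
  rw [continuous_iff_continuousAt]
  intro x₀
  rw [ContinuousAt, Metric.tendsto_nhds]
  intro e he
  have hδ : 0 < e / (|b - a| + 1) := by positivity
  filter_upwards [wp_unif (f := fun (x : s) t => f x t) (isCompact_uIcc (a := a) (b := b))
    (fun y _ => hg.continuousAt (x := (x₀, y))) hδ] with x hx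
  have hi : ∀ x : s, IntervalIntegrable (f x) MeasureTheory.volume a b := fun x =>
    Continuous.intervalIntegrable (hg.comp (f := fun t : ℝ => (x, t)) (by fun_prop)) a b
  simp only [domRestrict_apply]
  rw [dist_eq_norm, ← intervalIntegral.integral_sub (hi x) (hi x₀)]
  have := intervalIntegral.norm_integral_le_of_norm_le_const (a := a) (b := b)
    (f := fun t => f x t - f x₀ t) (C := e / (|b - a| + 1))
    (fun t ht => (hx t (uIoc_subset_uIcc ht)).le)
  refine this.trans_lt ?_
  rw [div_mul_eq_mul_div, div_lt_iff₀ (by positivity)]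
  nlinarith

variable {E G : Type*} [NormedAddCommGroup E] [NormedSpace ℂ E] [FiniteDimensional ℂ E]
  [NormedAddCommGroup G] [NormedSpace ℂ G]

theorem wp_fderiv_cont {X : Type*} [TopologicalSpace X] {f : X → E → G} {V : Set E}
    (hV : IsOpen V) (hc : ContinuousOn (fun p : X × E => f p.1 p.2) (univ ×ˢ V))
    (hd : ∀ x, DifferentiableOn ℂ (f x) V) :
    ContinuousOn (fun p : X × E => fderiv ℂ (f p.1) p.2) (univ ×ˢ V) := by
  have : ProperSpace E := FiniteDimensional.proper ℂ E
  have hca : ∀ x, ∀ z ∈ V, ContinuousAt (fun p : X × E => f p.1 p.2) (x, z) := fun x z hz =>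
    hc.continuousAt ((isOpen_univ.prod hV).mem_nhds ⟨mem_univ _, hz⟩)
  rintro ⟨x₀, z₀⟩ ⟨-, hz₀⟩
  simp only at hz₀
  apply ContinuousAt.continuousWithinAt
  obtain ⟨R, hR, hRV⟩ := Metric.isOpen_iff.1 hV z₀ hz₀
  set ρ := R / 3 with hρ
  have hρ0 : 0 < ρ := by positivity
  rw [ContinuousAt, Metric.tendsto_nhds]
  intro e he
  -- parameter `(x, z)`, variable `w ∈ closedBall 0 ρ`
  have hu := wp_unif (f := fun (p : X × E) (w : E) => f p.1 (p.2 + w)) (x₀ := (x₀, z₀))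
    (isCompact_closedBall (0 : E) ρ) (δ := e * ρ / 4) (fun w hw => by
      refine ContinuousAt.comp (f := fun q : (X × E) × E => (q.1.1, q.1.2 + q.2))
        (g := fun p : X × E => f p.1 p.2) ?_ (by fun_prop)
      refine hca _ _ (hRV ?_)
      simp only [mem_closedBall, dist_zero_right] at hw
      simp only [mem_ball, dist_self_add_left]
      linarith) (by positivity)
  have hz : ∀ᶠ p : X × E in 𝓝 (x₀, z₀), p.2 ∈ ball z₀ ρ :=
    continuousAt_snd.eventually (ball_mem_nhds z₀ hρ0)
  filter_upwards [hu, hz] with p hp hpz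
  rw [mem_ball, dist_eq_norm] at hpz
  have hV1 : ∀ w ∈ ball (0 : E) ρ, p.2 + w ∈ V := fun w hw => hRV (by
    rw [mem_ball, dist_zero_right] at hw
    rw [mem_ball, dist_eq_norm]
    calc ‖p.2 + w - z₀‖ = ‖(p.2 - z₀) + w‖ := by congr 1; abel
      _ ≤ ‖p.2 - z₀‖ + ‖w‖ := norm_add_le _ _
      _ < R := by linarith)
  have hV2 : ∀ w ∈ ball (0 : E) ρ, z₀ + w ∈ V := fun w hw => hRV (by
    rw [mem_ball, dist_zero_right] at hw
    simp only [mem_ball, dist_self_add_left]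
    linarith)
  have hd1 : ∀ (x : X) (z : E), (∀ w ∈ ball (0 : E) ρ, z + w ∈ V) →
      DifferentiableOn ℂ (fun w => f x (z + w)) (ball 0 ρ) := fun x z h =>
    (hd x).comp (f := fun w => z + w) (by fun_prop) h
  have hf1 : ∀ (x : X) (z : E), (∀ w ∈ ball (0 : E) ρ, z + w ∈ V) →
      fderiv ℂ (fun w => f x (z + w)) 0 = fderiv ℂ (f x) z := fun x z h => by
    rw [fderiv_comp_add_left]; simp
  have key := Complex.norm_fderiv_le_div_of_mapsTo_ball (R₁ := ρ) (R₂ := e * ρ / 2) (c := (0 : E))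
    (f := fun w => f p.1 (p.2 + w) - f x₀ (z₀ + w))
    ((hd1 _ _ hV1).sub (hd1 _ _ hV2)) (fun w hw => by
      have h1 := hp w (ball_subset_closedBall hw)
      have h2 := hp 0 (mem_closedBall_self hρ0.le)
      rw [mem_closedBall, dist_eq_norm]
      refine (norm_sub_le _ _).trans ?_
      linarith) hρ0
  rw [fderiv_fun_sub ((hd1 _ _ hV1).differentiableAt (ball_mem_nhds _ hρ0))
    ((hd1 _ _ hV2).differentiableAt (ball_mem_nhds _ hρ0)), hf1 _ _ hV1, hf1 _ _ hV2] at key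
  rw [dist_eq_norm]
  refine key.trans_lt ?_
  rw [div_lt_iff₀ hρ0]
  nlinarith [mul_pos he hρ0]

theorem wp_diff_integral {f : ℝ → E → G} {V : Set E}
    (hV : IsOpen V) (hc : ContinuousOn (fun p : ℝ × E => f p.1 p.2) (univ ×ˢ V))
    (hd : ∀ t, DifferentiableOn ℂ (f t) V) (a b : ℝ) :
    DifferentiableOn ℂ (fun z => ∫ t in a..b, f t z) V := by
  intro z₀ hz₀
  apply DifferentiableAt.differentiableWithinAt
  have hc' := wp_fderiv_cont hV hc hd
  have hft : ∀ z ∈ V, Continuous (fun t => f t z) := fun z hz =>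
    hc.comp_continuous (f := fun t : ℝ => (t, z)) (by fun_prop) (fun t => ⟨mem_univ _, hz⟩)
  have hft' : ∀ z ∈ V, Continuous (fun t => fderiv ℂ (f t) z) := fun z hz =>
    hc'.comp_continuous (f := fun t : ℝ => (t, z)) (by fun_prop) (fun t => ⟨mem_univ _, hz⟩)
  have hu := wp_unif (f := fun (z : E) (t : ℝ) => fderiv ℂ (f t) z) (x₀ := z₀)
    (isCompact_uIcc (a := a) (b := b)) (δ := 1) (fun t _ => by
      refine ContinuousAt.comp (f := fun q : E × ℝ => (q.2, q.1))
        (g := fun p : ℝ × E => fderiv ℂ (f p.1) p.2) ?_ (by fun_prop)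
      exact hc'.continuousAt ((isOpen_univ.prod hV).mem_nhds ⟨mem_univ _, hz₀⟩)) one_pos
  have hs := hu.and (hV.mem_nhds hz₀)
  refine (intervalIntegral.hasFDerivAt_integral_of_dominated_of_fderiv_le
    (F := fun z t => f t z) (F' := fun z t => fderiv ℂ (f t) z)
    (bound := fun t => ‖fderiv ℂ (f t) z₀‖ + 1) (s := {z | (∀ y ∈ uIcc a b,
      ‖fderiv ℂ (f y) z - fderiv ℂ (f y) z₀‖ < 1) ∧ z ∈ V})
    (μ := MeasureTheory.volume) (a := a) (b := b) hs ?_ ?_ ?_ ?_ ?_ ?_).differentiableAt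
  · filter_upwards [hV.mem_nhds hz₀] with z hz
    exact (hft z hz).aestronglyMeasurable
  · exact (hft z₀ hz₀).intervalIntegrable a b
  · exact (hft' z₀ hz₀).aestronglyMeasurable
  · refine Eventually.of_forall fun t ht z hz => ?_
    have h1 := hz.1 t (uIoc_subset_uIcc ht)
    have h2 := norm_sub_norm_le (fderiv ℂ (f t) z) (fderiv ℂ (f t) z₀)
    linarith
  · exact ((hft' z₀ hz₀).norm.add continuous_const).intervalIntegrable a b
  · exact Eventually.of_forall fun t ht z hz =>
      ((hd t).differentiableAt (hV.mem_nhds hz.2)).hasFDerivAt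

theorem wp_diff_clm {f : E → E →L[ℂ] G} {s : Set E}
    (h : ∀ y, DifferentiableOn ℂ (fun x => f x y) s) : DifferentiableOn ℂ f s := by
  let d := Module.finrank ℂ E
  have hd : d = Module.finrank ℂ (Fin d → ℂ) := (Module.finrank_fin_fun ℂ).symm
  let e₁ := ContinuousLinearEquiv.ofFinrankEq hd
  let e₂ := (e₁.arrowCongr (1 : G ≃L[ℂ] G)).trans (ContinuousLinearEquiv.piRing (Fin d))
  rw [← Function.id_comp f, ← e₂.symm_comp_self]
  exact e₂.symm.differentiable.comp_differentiableOn (differentiableOn_pi.mpr fun i => h _)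

theorem wp_fderiv_diff [CompleteSpace G] {f : E → G} {V : Set E} (hV : IsOpen V)
    (hd : DifferentiableOn ℂ f V) : DifferentiableOn ℂ (fderiv ℂ f) V := by
  apply wp_diff_clm
  intro v z₀ hz₀
  apply DifferentiableAt.differentiableWithinAt
  obtain ⟨R, hR, hRV⟩ := Metric.isOpen_iff.1 hV z₀ hz₀
  set ρ := R / (2 * (‖v‖ + 1)) with hρ
  have hρ0 : 0 < ρ := by positivity
  have hρv : ρ * ‖v‖ < R / 2 := by
    rw [hρ, div_mul_eq_mul_div, div_lt_div_iff₀ (by positivity) (by positivity)]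
    nlinarith [norm_nonneg v]
  have hin : ∀ z ∈ ball z₀ (R / 2), ∀ ζ : ℂ, ‖ζ‖ ≤ ρ → z + ζ • v ∈ V := fun z hz ζ hζ => hRV (by
    rw [mem_ball, dist_eq_norm] at *
    calc ‖z + ζ • v - z₀‖ = ‖(z - z₀) + ζ • v‖ := by congr 1; abel
      _ ≤ ‖z - z₀‖ + ‖ζ‖ * ‖v‖ := (norm_add_le _ _).trans_eq (by rw [norm_smul])
      _ ≤ ‖z - z₀‖ + ρ * ‖v‖ := by gcongr
      _ < R := by linarith)
  have hcirc : ∀ θ : ℝ, ‖circleMap 0 ρ θ‖ ≤ ρ := fun θ => by simp [abs_of_pos hρ0]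
  -- the integral formula
  have hform : ∀ z ∈ ball z₀ (R / 2), fderiv ℂ f z v = (2 * Real.pi * Complex.I)⁻¹ •
      ∮ ζ in C(0, ρ), (1 / (ζ - 0) ^ 2) • f (z + ζ • v) := by
    intro z hz
    have hg : DifferentiableOn ℂ (fun ζ : ℂ => f (z + ζ • v)) (closedBall 0 ρ) :=
      hd.comp (f := fun ζ : ℂ => z + ζ • v) (by fun_prop)
        (fun ζ hζ => hin z hz ζ (by simpa using hζ))
    rw [hg.deriv_eq_smul_circleIntegral hρ0, smul_smul, inv_mul_cancel₀ Complex.two_pi_I_ne_zero,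
      one_smul]
    have hfz : HasFDerivAt f (fderiv ℂ f z) (z + (0 : ℂ) • v) := by
      have : z ∈ V := by simpa using hin z hz 0 (by simpa using hρ0.le)
      simpa using (hd.differentiableAt (hV.mem_nhds this)).hasFDerivAt
    have hl : HasDerivAt (fun ζ : ℂ => z + ζ • v) v 0 := by
      simpa using ((hasDerivAt_id (0 : ℂ)).smul_const v).const_add z
    exact (hfz.comp_hasDerivAt (0 : ℂ) hl).deriv.symm
  have hev : (fun z => fderiv ℂ f z v) =ᶠ[𝓝 z₀] fun z => (2 * Real.pi * Complex.I)⁻¹ •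
      ∮ ζ in C(0, ρ), (1 / (ζ - 0) ^ 2) • f (z + ζ • v) := by
    filter_upwards [ball_mem_nhds z₀ (half_pos hR)] with z hz using hform z hz
  refine DifferentiableAt.congr_of_eventuallyEq ?_ hev
  refine DifferentiableAt.const_smul ?_ _
  have hco : Continuous fun θ : ℝ => deriv (circleMap 0 ρ) θ := by
    simp only [deriv_circleMap]; fun_prop
  have hcc : Continuous fun θ : ℝ => (1 / (circleMap 0 ρ θ - 0) ^ 2 : ℂ) := by
    refine continuous_const.div (by fun_prop) fun θ => ?_
    simp [hρ0.ne']
  refine (wp_diff_integral (V := ball z₀ (R / 2)) isOpen_ball (f := fun θ z =>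
    deriv (circleMap 0 ρ) θ • (1 / (circleMap 0 ρ θ - 0) ^ 2 : ℂ) • f (z + circleMap 0 ρ θ • v))
    ?_ ?_ 0 (2 * Real.pi)).differentiableAt (ball_mem_nhds z₀ (half_pos hR))
  · refine (hco.comp continuous_fst).continuousOn.smul
      ((hcc.comp continuous_fst).continuousOn.smul ?_)
    exact hd.continuousOn.comp (f := fun p : ℝ × E => p.2 + circleMap 0 ρ p.1 • v)
      (by fun_prop) (fun p hp => hin _ hp.2 _ (hcirc _))
  · intro θ
    refine DifferentiableOn.const_smul (DifferentiableOn.const_smul ?_ _) _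
    exact hd.comp (f := fun z => z + circleMap 0 ρ θ • v) (by fun_prop)
      (fun z hz => hin _ hz _ (hcirc _))

theorem wp_iter {E : Type} [NormedAddCommGroup E] [NormedSpace ℂ E] [FiniteDimensional ℂ E]
    {X : Type*} [TopologicalSpace X] {V : Set E} (hV : IsOpen V) (n : ℕ) :
    ∀ {G : Type} [NormedAddCommGroup G] [NormedSpace ℂ G] [CompleteSpace G] {f : X → E → G}
    (_ : ContinuousOn (fun p : X × E => f p.1 p.2) (univ ×ˢ V))
    (_ : ∀ x, DifferentiableOn ℂ (f x) V),
    ContinuousOn (fun p : X × E => iteratedFDeriv ℂ n (f p.1) p.2) (univ ×ˢ V) := by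
  induction n with
  | zero =>
    intro G _ _ _ f hc hd
    simp only [iteratedFDeriv_zero_eq_comp]
    exact (LinearIsometryEquiv.continuous _).comp_continuousOn hc
  | succ n ih =>
    intro G _ _ _ f hc hd
    simp only [iteratedFDeriv_succ_eq_comp_right]
    exact (LinearIsometryEquiv.continuous _).comp_continuousOn
      (ih (f := fun x => fderiv ℂ (f x)) (wp_fderiv_cont hV hc hd)
        (fun x => wp_fderiv_diff hV (hd x)))

/-- Existence of a zero by contraction. -/
theorem wp_zero {g : ℂ → ℂ} {c : ℂ} {c₀ r : ℝ} (hc₀ : 0 < c₀) (hc : c₀ ≤ ‖c‖) (hr : 0 < r)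
    (hg : ∀ z ∈ closedBall (0 : ℂ) r, ∀ w ∈ closedBall (0 : ℂ) r,
      ‖g z - g w - c * (z - w)‖ ≤ c₀ / 2 * ‖z - w‖)
    (h0 : ‖g 0‖ < c₀ * r / 4) : ∃ a ∈ ball (0 : ℂ) r, g a = 0 := by
  have hcn : 0 < ‖c‖ := hc₀.trans_le hc
  have hc0 : c ≠ 0 := norm_pos_iff.1 hcn
  set T : ℂ → ℂ := fun z => z - g z / c with hT
  have hTl : ∀ z ∈ closedBall (0 : ℂ) r, ∀ w ∈ closedBall (0 : ℂ) r,
      ‖T z - T w‖ ≤ 1 / 2 * ‖z - w‖ := by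
    intro z hz w hw
    have h1 : T z - T w = -((g z - g w - c * (z - w)) / c) := by
      simp only [hT]; field_simp; ring
    rw [h1, norm_neg, norm_div, div_le_iff₀ hcn]
    refine (hg z hz w hw).trans ?_
    nlinarith [norm_nonneg (z - w)]
  have hT0 : ‖T 0‖ < r / 4 := by
    simp only [hT, zero_sub, norm_neg, norm_div]
    rw [div_lt_iff₀ hcn]
    nlinarith
  have hm0 : (0 : ℂ) ∈ closedBall (0 : ℂ) r := mem_closedBall_self hr.le
  have hTb : ∀ z ∈ closedBall (0 : ℂ) r, ‖T z‖ < r := by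
    intro z hz
    have h1 := hTl z hz 0 hm0
    have h2 := norm_sub_norm_le (T z) (T 0)
    rw [mem_closedBall, dist_zero_right] at hz
    rw [sub_zero] at h1
    linarith
  have hmaps : MapsTo T (closedBall (0 : ℂ) r) (closedBall (0 : ℂ) r) := fun z hz => by
    simpa using (hTb z hz).le
  have hcon : ContractingWith (1 / 2) (hmaps.restrict T _ _) := by
    refine ⟨by norm_num, LipschitzWith.of_dist_le_mul fun z w => ?_⟩
    have := hTl z z.2 w w.2
    simpa [Subtype.dist_eq, dist_eq_norm] using this
  obtain ⟨a, ha, hfix, -⟩ := hcon.exists_fixedPoint' (isClosed_closedBall.isComplete) hmaps hm0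
    (edist_ne_top _ _)
  refine ⟨a, ?_, ?_⟩
  · have := hTb a ha
    rw [hfix.eq] at this
    simpa using this
  · have h1 : a - g a / c = a := hfix
    have h2 : g a / c = 0 := by linear_combination -h1
    simpa [hc0] using h2

/-- Differentiability of an implicitly defined function. -/
theorem wp_implicit {F : ℂ × E → ℂ} {A : E → ℂ} {z₀ : E} (hA : ContinuousAt A z₀)
    (hF : DifferentiableAt ℂ F (A z₀, z₀)) (hne : fderiv ℂ F (A z₀, z₀) (1, 0) ≠ 0)
    (h0 : ∀ᶠ z in 𝓝 z₀, F (A z, z) = 0) {C : ℝ}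
    (hlip : ∀ᶠ z in 𝓝 z₀, ‖A z - A z₀‖ ≤ C * ‖F (A z₀, z) - F (A z₀, z₀)‖) :
    DifferentiableAt ℂ A z₀ := by
  set L := fderiv ℂ F (A z₀, z₀) with hL
  set c := L (1, 0) with hcdef
  have hA1 : (fun z => A z - A z₀) =O[𝓝 z₀] fun z => z - z₀ := by
    have h1 : (fun z => A z - A z₀) =O[𝓝 z₀] fun z => F (A z₀, z) - F (A z₀, z₀) :=
      Asymptotics.IsBigO.of_bound C hlip
    refine h1.trans ?_
    have h2 : DifferentiableAt ℂ (fun z => F (A z₀, z)) z₀ :=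
      DifferentiableAt.comp (f := fun z : E => (A z₀, z)) (g := F) z₀ hF (by fun_prop)
    exact h2.hasFDerivAt.isBigO_sub
  have hcont : Tendsto (fun z => (A z, z)) (𝓝 z₀) (𝓝 (A z₀, z₀)) :=
    hA.prodMk continuousAt_id
  have hlo := (hF.hasFDerivAt.isLittleO).comp_tendsto hcont
  have hbig : ((fun p : ℂ × E => p - (A z₀, z₀)) ∘ fun z => (A z, z)) =O[𝓝 z₀]
      fun z => z - z₀ := hA1.prod_left (Asymptotics.isBigO_refl _ _)
  have hlo2 := hlo.trans_isBigO hbig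
  have hF0 := h0.self_of_nhds
  refine HasFDerivAt.differentiableAt
    (f' := -(c⁻¹ • (L.comp (ContinuousLinearMap.inr ℂ ℂ E)))) ?_
  rw [hasFDerivAt_iff_isLittleO]
  refine (hlo2.const_mul_left (-c⁻¹)).congr' ?_ (EventuallyEq.refl _ _)
  filter_upwards [h0] with z hz
  have hsplit : L ((A z, z) - (A z₀, z₀)) = c * (A z - A z₀) + L (0, z - z₀) := by
    have : ((A z, z) - (A z₀, z₀) : ℂ × E) = (A z - A z₀) • (1, 0) + (0, z - z₀) := by
      ext <;> simp
    rw [this, map_add, map_smul, smul_eq_mul, mul_comm]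
  simp only [Function.comp_apply, hz, hF0, ← hL]
  rw [hsplit]
  simp
  field_simp
  ring

theorem wp_main {E : Type} [NormedAddCommGroup E] [NormedSpace ℂ E] [FiniteDimensional ℂ E]
    (S : Type*) [TopologicalSpace S] [CompactSpace S]
    (U : Set (ℂ × E)) (hUopen : IsOpen U)
    (hU0 : (0 : ℂ × E) ∈ U)
    (W : S → ℂ × E → ℂ)
    (hWcont : ContinuousOn (fun q : S × (ℂ × E) => W q.1 q.2) (univ ×ˢ U))
    (hWhol : ∀ s, DifferentiableOn ℂ (W s) U)
    (hW0 : ∀ s, W s 0 = 0)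
    (hWz1 : ∀ s, deriv (fun z₁ : ℂ => W s (z₁, 0)) 0 ≠ 0) :
    ∃ r ε : ℝ, 0 < r ∧ 0 < ε ∧
      ball (0 : ℂ) r ×ˢ ball (0 : E) ε ⊆ U ∧
      ∃ (A : S → E → ℂ) (B : S → ℂ × E → ℂ),
        (∀ s, DifferentiableOn ℂ (A s) (ball 0 ε)) ∧
        (∀ s, DifferentiableOn ℂ (B s) (ball (0 : ℂ) r ×ˢ ball (0 : E) ε)) ∧
        (∀ s, A s 0 = 0) ∧
        (∀ s, ∀ z ∈ ball (0 : ℂ) r ×ˢ ball (0 : E) ε, B s z ≠ 0) ∧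
        (∀ s, ∀ z ∈ ball (0 : ℂ) r ×ˢ ball (0 : E) ε, W s z = (z.1 - A s z.2) * B s z) ∧
        (∀ n : ℕ, ContinuousOn
          (fun q : S × E => iteratedFDeriv ℂ n (A q.1) q.2) (univ ×ˢ ball (0 : E) ε)) ∧
        (∀ n : ℕ, ContinuousOn
          (fun q : S × (ℂ × E) => iteratedFDeriv ℂ n (B q.1) q.2)
          (univ ×ˢ (ball (0 : ℂ) r ×ˢ ball (0 : E) ε))) := by
  -- the derivative in the first variable
  set D : S → ℂ × E → ℂ := fun s z => fderiv ℂ (W s) z (1, 0) with hD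
  have hDc : ContinuousOn (fun q : S × (ℂ × E) => D q.1 q.2) (univ ×ˢ U) :=
    (wp_fderiv_cont hUopen hWcont hWhol).clm_apply continuousOn_const
  have hDd : ∀ s, DifferentiableOn ℂ (D s) U := fun s =>
    (wp_fderiv_diff hUopen (hWhol s)).clm_apply (differentiableOn_const _)
  have hline : ∀ s (z' : E) (z₁ : ℂ), (z₁, z') ∈ U →
      HasDerivAt (fun w : ℂ => W s (w, z')) (D s (z₁, z')) z₁ := by
    intro s z' z₁ hz
    have h1 := ((hWhol s).differentiableAt (hUopen.mem_nhds hz)).hasFDerivAt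
    have h2 : HasDerivAt (fun w : ℂ => (w, z')) ((1 : ℂ), (0 : E)) z₁ :=
      (hasDerivAt_id z₁).prodMk (hasDerivAt_const z₁ z')
    exact h1.comp_hasDerivAt z₁ h2
  have hD0 : ∀ s, D s 0 ≠ 0 := fun s => by
    have := (hline s 0 0 hU0).deriv
    have h := hWz1 s
    rw [this] at h
    exact h
  have hnhds : ∀ s : S, ∀ z ∈ U, (univ : Set S) ×ˢ U ∈ 𝓝 (s, z) := fun s z hz =>
    (isOpen_univ.prod hUopen).mem_nhds ⟨mem_univ _, hz⟩
  -- uniform lower bound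
  obtain ⟨c₀, hc₀, hcb⟩ : ∃ c₀ : ℝ, 0 < c₀ ∧ ∀ s, c₀ ≤ ‖D s 0‖ := by
    have hcs : Continuous fun s => ‖D s 0‖ :=
      (hDc.comp_continuous (f := fun s : S => (s, (0 : ℂ × E))) (by fun_prop)
        (fun s => ⟨mem_univ _, hU0⟩)).norm
    rcases isEmpty_or_nonempty S with h | h
    · exact ⟨1, one_pos, fun s => h.elim s⟩
    · obtain ⟨s, hs⟩ :=
        (isCompact_univ (X := S)).exists_isMinOn univ_nonempty hcs.continuousOn
      exact ⟨‖D s 0‖, norm_pos_iff.2 (hD0 s), fun t => hs.2 (mem_univ t)⟩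
  -- uniform closeness
  have hswap : ∀ (f : S → ℂ × E → ℂ),
      ContinuousOn (fun q : S × (ℂ × E) => f q.1 q.2) (univ ×ˢ U) → ∀ δ : ℝ, 0 < δ →
      ∀ᶠ z in 𝓝 (0 : ℂ × E), ∀ s, ‖f s z - f s 0‖ < δ := by
    intro f hf δ hδ
    have := wp_unif (f := fun (z : ℂ × E) (s : S) => f s z) (x₀ := 0) (isCompact_univ (X := S))
      (fun s _ => by
        refine ContinuousAt.comp (f := fun q : (ℂ × E) × S => (q.2, q.1))
          (g := fun p : S × (ℂ × E) => f p.1 p.2) ?_ (by fun_prop)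
        exact hf.continuousAt (hnhds s 0 hU0)) hδ
    filter_upwards [this] with z hz s using hz s (mem_univ s)
  obtain ⟨δ, hδ, hδb⟩ := Metric.eventually_nhds_iff_ball.1
    ((hswap D hDc (c₀ / 2) (by positivity)).and (hUopen.mem_nhds hU0))
  set r := δ / 2 with hr
  have hr0 : 0 < r := by positivity
  obtain ⟨η, hη, hηb⟩ := Metric.eventually_nhds_iff_ball.1
    (hswap W hWcont (c₀ * r / 4) (by positivity))
  set ε := min δ η with hε
  have hε0 : 0 < ε := lt_min hδ hη
  have hin : ∀ z₁ ∈ closedBall (0 : ℂ) r, ∀ z' ∈ ball (0 : E) ε, (z₁, z') ∈ ball (0 : ℂ × E) δ := by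
    intro z₁ h1 z' h2
    rw [mem_closedBall, dist_zero_right] at h1
    rw [mem_ball, dist_zero_right] at h2
    rw [mem_ball, dist_zero_right, Prod.norm_def, max_lt_iff]
    exact ⟨by simp only; linarith, h2.trans_le (min_le_left _ _)⟩
  have hinU : ∀ z₁ ∈ closedBall (0 : ℂ) r, ∀ z' ∈ ball (0 : E) ε, (z₁, z') ∈ U :=
    fun z₁ h1 z' h2 => (hδb _ (hin z₁ h1 z' h2)).2
  have hbc : ball (0 : ℂ) r ⊆ closedBall 0 r := ball_subset_closedBall
  have hDne : ∀ s, ∀ z₁ ∈ closedBall (0 : ℂ) r, ∀ z' ∈ ball (0 : E) ε, D s (z₁, z') ≠ 0 := by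
    intro s z₁ h1 z' h2 h
    have h3 := (hδb _ (hin z₁ h1 z' h2)).1 s
    rw [h, zero_sub, norm_neg] at h3
    linarith [hcb s]
  -- approximate linearity
  have hlin : ∀ s, ∀ z' ∈ ball (0 : E) ε, ∀ z ∈ closedBall (0 : ℂ) r, ∀ w ∈ closedBall (0 : ℂ) r,
      ‖W s (z, z') - W s (w, z') - D s 0 * (z - w)‖ ≤ c₀ / 2 * ‖z - w‖ := by
    intro s z' hz' z hz w hw
    have := (convex_closedBall (0 : ℂ) r).norm_image_sub_le_of_norm_hasDerivWithin_le
      (f := fun x => W s (x, z') - D s 0 * x) (f' := fun x => D s (x, z') - D s 0 * 1)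
      (C := c₀ / 2) (fun x hx => ((hline s z' x (hinU x hx z' hz')).sub
        ((hasDerivAt_id x).const_mul (D s 0))).hasDerivWithinAt)
      (fun x hx => by simpa using ((hδb _ (hin x hx z' hz')).1 s).le) hw hz
    have he : W s (z, z') - W s (w, z') - D s 0 * (z - w) =
        (W s (z, z') - D s 0 * z) - (W s (w, z') - D s 0 * w) := by ring
    rw [he]
    exact this
  have hlow : ∀ s, ∀ z' ∈ ball (0 : E) ε, ∀ z ∈ closedBall (0 : ℂ) r, ∀ w ∈ closedBall (0 : ℂ) r,
      ‖z - w‖ ≤ 2 / c₀ * ‖W s (z, z') - W s (w, z')‖ := by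
    intro s z' hz' z hz w hw
    have h1 := hlin s z' hz' z hz w hw
    have h2 := norm_sub_norm_le (D s 0 * (z - w)) (W s (z, z') - W s (w, z'))
    rw [norm_sub_rev, norm_mul] at h2
    have h2' : ‖D s 0‖ * ‖z - w‖ - ‖W s (z, z') - W s (w, z')‖ ≤ c₀ / 2 * ‖z - w‖ := by
      refine le_trans ?_ h1
      have := norm_sub_norm_le (D s 0 * (z - w)) (W s (z, z') - W s (w, z'))
      rw [norm_mul] at this
      rwa [norm_sub_rev (W s (z, z') - W s (w, z'))]
    have h3 := mul_le_mul_of_nonneg_right (hcb s) (norm_nonneg (z - w))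
    rw [div_mul_eq_mul_div, le_div_iff₀ hc₀]
    linarith
  -- the zero
  have hex : ∀ s, ∀ z' ∈ ball (0 : E) ε, ∃ a ∈ ball (0 : ℂ) r, W s (a, z') = 0 := by
    intro s z' hz'
    refine wp_zero (g := fun x => W s (x, z')) hc₀ (hcb s) hr0 (hlin s z' hz') ?_
    have := hηb (0, z') (by
      rw [mem_ball, dist_zero_right] at *
      rw [Prod.norm_def]
      simpa [hη] using hz'.trans_le (min_le_right _ _)) s
    simpa [hW0] using this
  have hex' : ∀ s z', ∃ a : ℂ, z' ∈ ball (0 : E) ε → a ∈ ball (0 : ℂ) r ∧ W s (a, z') = 0 := by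
    intro s z'
    by_cases h : z' ∈ ball (0 : E) ε
    · obtain ⟨a, ha⟩ := hex s z' h
      exact ⟨a, fun _ => ha⟩
    · exact ⟨0, fun h' => (h h').elim⟩
  choose A hA using hex'
  have hAb : ∀ s, ∀ z' ∈ ball (0 : E) ε, A s z' ∈ closedBall (0 : ℂ) r := fun s z' h =>
    hbc (hA s z' h).1
  have hAcont : ContinuousOn (fun q : S × E => A q.1 q.2) (univ ×ˢ ball (0 : E) ε) := by
    rintro ⟨s₀, z₀⟩ ⟨-, hz₀⟩
    simp only at hz₀
    apply ContinuousAt.continuousWithinAt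
    have hWt : ContinuousAt (fun q : S × E => W q.1 (A s₀ z₀, q.2)) (s₀, z₀) := by
      refine ContinuousAt.comp (f := fun q : S × E => (q.1, (A s₀ z₀, q.2)))
        (g := fun p : S × (ℂ × E) => W p.1 p.2) ?_ (by fun_prop)
      exact hWcont.continuousAt (hnhds _ _ (hinU _ (hAb s₀ z₀ hz₀) _ hz₀))
    have hlim : Tendsto (fun q : S × E => 2 / c₀ * ‖W q.1 (A s₀ z₀, q.2)‖) (𝓝 (s₀, z₀)) (𝓝 0) := by
      have := (hWt.norm.const_mul (2 / c₀)).tendsto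
      simpa [(hA s₀ z₀ hz₀).2] using this
    refine tendsto_iff_norm_sub_tendsto_zero.2 (squeeze_zero' (Eventually.of_forall fun _ =>
      norm_nonneg _) ?_ hlim)
    have hz : ∀ᶠ q : S × E in 𝓝 (s₀, z₀), q.2 ∈ ball (0 : E) ε :=
      continuousAt_snd.eventually (isOpen_ball.mem_nhds hz₀)
    filter_upwards [hz] with q hq
    have := hlow q.1 q.2 hq _ (hAb q.1 q.2 hq) _ (hAb s₀ z₀ hz₀)
    simpa [(hA q.1 q.2 hq).2] using this
  have hAdiff : ∀ s, DifferentiableOn ℂ (A s) (ball 0 ε) := by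
    intro s z₀ hz₀
    apply DifferentiableAt.differentiableWithinAt
    have hball := isOpen_ball.mem_nhds hz₀
    refine wp_implicit (F := W s) (C := 2 / c₀) ?_ ?_ (hDne s _ (hAb s z₀ hz₀) _ hz₀) ?_ ?_
    · exact (hAcont.comp (f := fun z : E => (s, z)) (by fun_prop)
        (fun z hz => ⟨mem_univ _, hz⟩)).continuousAt hball
    · exact (hWhol s).differentiableAt (hUopen.mem_nhds (hinU _ (hAb s z₀ hz₀) _ hz₀))
    · filter_upwards [hball] with z hz using (hA s z hz).2
    · filter_upwards [hball] with z hz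
      have := hlow s z hz _ (hAb s z hz) _ (hAb s z₀ hz₀)
      rw [(hA s z hz).2, zero_sub, norm_neg] at this
      rwa [(hA s z₀ hz₀).2, sub_zero]
  -- the quotient
  set τ : ℝ → ℝ := fun t => max 0 (min 1 t) with hτ
  have hτc : Continuous τ := by fun_prop
  have hτ0 : ∀ t, 0 ≤ τ t := fun t => le_max_left _ _
  have hτ1 : ∀ t, τ t ≤ 1 := fun t => max_le zero_le_one (min_le_left _ _)
  have hτe : ∀ t ∈ Icc (0 : ℝ) 1, τ t = t := fun t ht => by
    simp [hτ, ht.1, ht.2]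
  set V := ball (0 : ℂ) r ×ˢ ball (0 : E) ε with hV
  have hVo : IsOpen V := isOpen_ball.prod isOpen_ball
  have hseg : ∀ s t, ∀ z ∈ V, A s z.2 + (τ t : ℂ) * (z.1 - A s z.2) ∈ closedBall (0 : ℂ) r := by
    intro s t z hz
    have := (convex_closedBall (0 : ℂ) r).add_smul_sub_mem (hAb s z.2 hz.2) (hbc hz.1)
      ⟨hτ0 t, hτ1 t⟩
    simpa using this
  set H : S → ℝ → ℂ × E → ℂ := fun s t z =>
    D s (A s z.2 + (τ t : ℂ) * (z.1 - A s z.2), z.2) with hH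
  have hHc : ContinuousOn (fun q : (S × (ℂ × E)) × ℝ => H q.1.1 q.2 q.1.2)
      ((univ ×ˢ V) ×ˢ univ) := by
    have hA' : ContinuousOn (fun q : (S × (ℂ × E)) × ℝ => A q.1.1 q.1.2.2)
        ((univ ×ˢ V) ×ˢ univ) :=
      hAcont.comp (f := fun q : (S × (ℂ × E)) × ℝ => (q.1.1, q.1.2.2)) (by fun_prop)
        (fun q hq => ⟨mem_univ _, hq.1.2.2⟩)
    refine hDc.comp (f := fun q : (S × (ℂ × E)) × ℝ =>
      (q.1.1, (A q.1.1 q.1.2.2 + (τ q.2 : ℂ) * (q.1.2.1 - A q.1.1 q.1.2.2), q.1.2.2))) ?_ ?_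
    · have hτ' : Continuous fun q : (S × (ℂ × E)) × ℝ => ((τ q.2 : ℝ) : ℂ) := by fun_prop
      have h1 : Continuous fun q : (S × (ℂ × E)) × ℝ => q.1.2.1 := by fun_prop
      have h2 : Continuous fun q : (S × (ℂ × E)) × ℝ => q.1.2.2 := by fun_prop
      have h3 : Continuous fun q : (S × (ℂ × E)) × ℝ => q.1.1 := by fun_prop
      exact h3.continuousOn.prodMk ((hA'.add (hτ'.continuousOn.mul
        (h1.continuousOn.sub hA'))).prodMk h2.continuousOn)
    · exact fun q hq => ⟨mem_univ _, hinU _ (hseg _ _ _ hq.1.2) _ hq.1.2.2⟩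
  have hHd : ∀ s t, DifferentiableOn ℂ (H s t) V := by
    intro s t
    have hA' : DifferentiableOn ℂ (fun z : ℂ × E => A s z.2) V :=
      (hAdiff s).comp (f := fun z : ℂ × E => z.2) (by fun_prop) (fun z hz => hz.2)
    refine (hDd s).comp (f := fun z : ℂ × E =>
      (A s z.2 + (τ t : ℂ) * (z.1 - A s z.2), z.2)) ?_
      (fun z hz => hinU _ (hseg _ _ _ hz) _ hz.2)
    exact (hA'.add ((differentiableOn_const _).mul (differentiableOn_fst.sub hA'))).prodMk
      differentiableOn_snd
  set B : S → ℂ × E → ℂ := fun s z => ∫ t in (0 : ℝ)..1, H s t z with hB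
  have hBc : ContinuousOn (fun q : S × (ℂ × E) => B q.1 q.2) (univ ×ˢ V) :=
    wp_cont_integral (f := fun (q : S × (ℂ × E)) t => H q.1 t q.2) hHc 0 1
  have hBd : ∀ s, DifferentiableOn ℂ (B s) V := by
    intro s
    refine wp_diff_integral hVo ?_ (hHd s) 0 1
    exact hHc.comp (f := fun p : ℝ × (ℂ × E) => ((s, p.2), p.1)) (by fun_prop)
      (fun p hp => ⟨⟨mem_univ _, hp.2⟩, mem_univ _⟩)
  have hWB : ∀ s, ∀ z ∈ V, W s z = (z.1 - A s z.2) * B s z := by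
    intro s z hz
    have hder : ∀ t ∈ uIcc (0 : ℝ) 1, HasDerivAt
        (fun t : ℝ => W s (A s z.2 + (t : ℂ) * (z.1 - A s z.2), z.2))
        ((z.1 - A s z.2) * H s t z) t := by
      intro t ht
      rw [uIcc_of_le zero_le_one] at ht
      have hm := hseg s t z hz
      have h1 := hline s z.2 _ (hinU _ hm _ hz.2)
      have h2 : HasDerivAt (fun t : ℝ => A s z.2 + (t : ℂ) * (z.1 - A s z.2))
          (z.1 - A s z.2) t := by
        simpa using ((Complex.ofRealCLM.hasDerivAt (x := t)).mul_const
          (z.1 - A s z.2)).const_add (A s z.2)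
      have h3 : D s (A s z.2 + (τ t : ℂ) * (z.1 - A s z.2), z.2) = H s t z := rfl
      rw [h3, hτe t ht] at h1
      rw [mul_comm]
      exact h1.comp t h2
    have hcont : Continuous fun t => H s t z :=
      hHc.comp_continuous (f := fun t : ℝ => ((s, z), t)) (by fun_prop)
        (fun t => ⟨⟨mem_univ _, hz⟩, mem_univ _⟩)
    have := intervalIntegral.integral_eq_sub_of_hasDerivAt hder
      ((continuous_const.mul hcont).intervalIntegrable 0 1)
    rw [intervalIntegral.integral_const_mul] at this
    simp only [Complex.ofReal_one, Complex.ofReal_zero, one_mul, zero_mul, add_zero,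
      (hA s z.2 hz.2).2, sub_zero, add_sub_cancel] at this
    exact this.symm
  have hB0 : ∀ s, ∀ z ∈ V, B s z ≠ 0 := by
    intro s z hz h
    by_cases hza : z.1 = A s z.2
    · have : B s z = D s (A s z.2, z.2) := by
        simp [hB, hH, hza]
      exact hDne s _ (hAb s _ hz.2) _ hz.2 (this ▸ h)
    · have h1 := hlow s z.2 hz.2 z.1 (hbc hz.1) _ (hAb s z.2 hz.2)
      have h2 : W s (z.1, z.2) = 0 := by
        have := hWB s z hz
        rw [h, mul_zero] at this
        exact this
      rw [h2, (hA s z.2 hz.2).2, sub_zero, norm_zero, mul_zero] at h1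
      exact hza (sub_eq_zero.1 (norm_le_zero_iff.1 h1))
  refine ⟨r, ε, hr0, hε0, fun z hz => hinU z.1 (hbc hz.1) z.2 hz.2, A, B, hAdiff, hBd, ?_, hB0,
    hWB, fun n => wp_iter isOpen_ball n hAcont hAdiff, fun n => wp_iter hVo n hBc hBd⟩
  intro s
  have h0 := mem_ball_self (x := (0 : E)) hε0
  have h1 := hlow s 0 h0 _ (hAb s 0 h0) 0 (mem_closedBall_self hr0.le)
  have h2 : W s ((0 : ℂ), (0 : E)) = 0 := hW0 s
  rw [h2, (hA s 0 h0).2, sub_zero, sub_zero, norm_zero, mul_zero] at h1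
  exact norm_le_zero_iff.1 h1

end helpers

/-- Weierstrass preparation with a compact parameter: there exist `r, ε > 0`
independent of `s ∈ S` and holomorphic `A_s`, `B_s` with `A_s(0) = 0`, `B_s ≠ 0`, and
`W(s,(z₁,z')) = (z₁ - A_s(z')) B_s(z₁,z')` on `B(0,r) × D'(0,ε)`; moreover `A`, `B` and all
their complex derivatives are jointly continuous in `(s, z)`. -/
theorem stmt_3 (d : ℕ) (hd : 2 ≤ d) (S : Type*) [TopologicalSpace S] [CompactSpace S]
    (U : Set (ℂ × EuclideanSpace ℂ (Fin (d - 1)))) (hUopen : IsOpen U)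
    (hU0 : (0 : ℂ × EuclideanSpace ℂ (Fin (d - 1))) ∈ U)
    (W : S → ℂ × EuclideanSpace ℂ (Fin (d - 1)) → ℂ)
    (hWcont : ContinuousOn
      (fun q : S × (ℂ × EuclideanSpace ℂ (Fin (d - 1))) => W q.1 q.2) (univ ×ˢ U))
    (hWhol : ∀ s, DifferentiableOn ℂ (W s) U)
    (hW0 : ∀ s, W s 0 = 0)
    (hWz1 : ∀ s, deriv (fun z₁ : ℂ => W s (z₁, 0)) 0 ≠ 0) :
    ∃ r ε : ℝ, 0 < r ∧ 0 < ε ∧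
      ball (0 : ℂ) r ×ˢ ball (0 : EuclideanSpace ℂ (Fin (d - 1))) ε ⊆ U ∧
      ∃ (A : S → EuclideanSpace ℂ (Fin (d - 1)) → ℂ)
        (B : S → ℂ × EuclideanSpace ℂ (Fin (d - 1)) → ℂ),
        (∀ s, DifferentiableOn ℂ (A s) (ball 0 ε)) ∧
        (∀ s, DifferentiableOn ℂ (B s)
          (ball (0 : ℂ) r ×ˢ ball (0 : EuclideanSpace ℂ (Fin (d - 1))) ε)) ∧
        (∀ s, A s 0 = 0) ∧
        (∀ s, ∀ z ∈ ball (0 : ℂ) r ×ˢ ball (0 : EuclideanSpace ℂ (Fin (d - 1))) ε,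
          B s z ≠ 0) ∧
        (∀ s, ∀ z ∈ ball (0 : ℂ) r ×ˢ ball (0 : EuclideanSpace ℂ (Fin (d - 1))) ε,
          W s z = (z.1 - A s z.2) * B s z) ∧
        (∀ n : ℕ, ContinuousOn
          (fun q : S × EuclideanSpace ℂ (Fin (d - 1)) => iteratedFDeriv ℂ n (A q.1) q.2)
          (univ ×ˢ ball (0 : EuclideanSpace ℂ (Fin (d - 1))) ε)) ∧
        (∀ n : ℕ, ContinuousOn
          (fun q : S × (ℂ × EuclideanSpace ℂ (Fin (d - 1))) =>
            iteratedFDeriv ℂ n (B q.1) q.2)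
          (univ ×ˢ (ball (0 : ℂ) r ×ˢ ball (0 : EuclideanSpace ℂ (Fin (d - 1))) ε))) := by
  exact wp_main S U hUopen hU0 W hWcont hWhol hW0 hWz1
end

section
/- (Inversion / parametrix at the symbol level) There exist a family a ∈ S̃^{−2} and a family r ∈ S̃^{−∞} such that (ℒ∘a)(s,k;x,ξ) = 1 − r(s,k;x,ξ) for all (s,k) ∈ 𝕊^{d−1} × [−π,π]^d and all (x,ξ) ∈ ℝ^d × ℝ^d. -/
noncomputable section

/-- The cube `[-π,π]^d` of quasimomenta. -/
def symbolCube (d : ℕ) : Set (EuclideanSpace ℝ (Fin d)) :=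
  {k | ∀ i, k i ∈ Set.Icc (-Real.pi) Real.pi}

/-- The phase space `(k, x, ξ)`. -/
abbrev PhSp (d : ℕ) :=
  EuclideanSpace ℝ (Fin d) × EuclideanSpace ℝ (Fin d) × EuclideanSpace ℝ (Fin d)

/-- The domain: `k` in the cube, `x` and `ξ` arbitrary. -/
def symbolDom (d : ℕ) : Set (PhSp d) := {p | p.1 ∈ symbolCube d}

/-- Iterated directional derivative (within a set) along a list of directions. -/
def listDerivWithin {X : Type*} [NormedAddCommGroup X] [NormedSpace ℝ X]
    (s : Set X) (vs : List X) (f : X → ℂ) : X → ℂ :=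
  vs.foldr (fun v g => fun p => fderivWithin ℝ g s p v) f

/-- Unit direction in the `k`-variable. -/
def dirK (d : ℕ) (i : Fin d) : PhSp d := (EuclideanSpace.single i 1, 0, 0)

/-- Unit direction in the `x`-variable. -/
def dirX (d : ℕ) (i : Fin d) : PhSp d := (0, EuclideanSpace.single i 1, 0)

/-- Unit direction in the `ξ`-variable. -/
def dirXi (d : ℕ) (i : Fin d) : PhSp d := (0, 0, EuclideanSpace.single i 1)

/-- The parameter-dependent symbol class `S̃^m`. -/
def IsSymbol (d : ℕ) (m : ℝ)
    (σ : Metric.sphere (0 : EuclideanSpace ℝ (Fin d)) 1 → PhSp d → ℂ) : Prop :=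
  (∀ s, ContDiffOn ℝ (⊤ : ℕ∞) (σ s) (symbolDom d)) ∧
  (∀ s, ∀ p ∈ symbolDom d, ∀ γ : Fin d → ℤ,
    σ s (p.1, p.2.1 + (WithLp.equiv 2 (Fin d → ℝ)).symm (fun i => (γ i : ℝ)), p.2.2)
      = σ s p) ∧
  (∀ Lk Lx Lξ : List (Fin d), ∃ C : ℝ, ∀ s, ∀ p ∈ symbolDom d,
    ‖listDerivWithin (symbolDom d)
        ((Lk.map (dirK d)) ++ (Lx.map (dirX d)) ++ (Lξ.map (dirXi d))) (σ s) p‖ ≤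
      C * (1 + ‖p.2.2‖) ^ (m - (Lk.length : ℝ) - (Lξ.length : ℝ)))

/-- The list of coordinate directions of a (bounded) multi-index: `i` repeated `β i` times. -/
def multiList {d m : ℕ} (β : Fin d → Fin (m + 1)) : List (Fin d) :=
  (List.finRange d).flatMap fun i => List.replicate (β i : ℕ) i

/-- The finite set of multi-indices `β` with `|β| ≤ m`. -/
def multiIdxSet (d m : ℕ) : Finset (Fin d → Fin (m + 1)) :=
  Finset.univ.filter fun β => (∑ i, (β i : ℕ)) ≤ m

/-- The composed symbol `(P∘a)(s,k;x,ξ) = ∑_{|β|≤m} (1/β!) D_ξ^β P · D_x^β a`. -/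
def composeSym (d m : ℕ)
    (P a : Metric.sphere (0 : EuclideanSpace ℝ (Fin d)) 1 → PhSp d → ℂ) :
    Metric.sphere (0 : EuclideanSpace ℝ (Fin d)) 1 → PhSp d → ℂ :=
  fun s p => ∑ β ∈ multiIdxSet d m,
    (((∏ i, Nat.factorial (β i : ℕ) : ℕ) : ℂ))⁻¹ *
      listDerivWithin (symbolDom d) ((multiList β).map (dirXi d)) (P s) p *
      listDerivWithin (symbolDom d) ((multiList β).map (dirX d)) (a s) p

/-- The full symbol `ℒ(s,k;x,ξ)` of `L - λ` with `ζ = ξ + k + iβ_s`: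
`∑ a_{jl}(x) ζ_j ζ_l + ∑ (D_j a_{jl})(x) ζ_l + V(x) - λ`. -/
def LSym (d : ℕ) (a : Fin d → Fin d → EuclideanSpace ℝ (Fin d) → ℝ)
    (V : EuclideanSpace ℝ (Fin d) → ℝ)
    (βmap : Metric.sphere (0 : EuclideanSpace ℝ (Fin d)) 1 → EuclideanSpace ℝ (Fin d))
    (lam : ℂ) :
    Metric.sphere (0 : EuclideanSpace ℝ (Fin d)) 1 → PhSp d → ℂ :=
  fun s p =>
    (∑ j, ∑ l, (a j l p.2.1 : ℂ) *
        ((p.2.2 j : ℂ) + (p.1 j : ℂ) + Complex.I * (βmap s j : ℂ)) *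
        ((p.2.2 l : ℂ) + (p.1 l : ℂ) + Complex.I * (βmap s l : ℂ))) +
    (∑ j, ∑ l, (-Complex.I * (fderiv ℝ (a j l) p.2.1 (EuclideanSpace.single j 1) : ℂ)) *
        ((p.2.2 l : ℂ) + (p.1 l : ℂ) + Complex.I * (βmap s l : ℂ))) +
    (V p.2.1 : ℂ) - lam


open Set

/-- Euclidean space. -/
abbrev Eu (d : ℕ) := EuclideanSpace ℝ (Fin d)

/-- coordinate directions in phase space -/
abbrev Dir (d : ℕ) := Fin d ⊕ Fin d ⊕ Fin d

/-- the direction vector -/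
def dirV {d : ℕ} : Dir d → PhSp d
  | Sum.inl i => dirK d i
  | Sum.inr (Sum.inl i) => dirX d i
  | Sum.inr (Sum.inr i) => dirXi d i

/-- the weight of a direction -/
def dirW {d : ℕ} : Dir d → ℝ
  | Sum.inl _ => 1
  | Sum.inr (Sum.inl _) => 0
  | Sum.inr (Sum.inr _) => 1

/-- lattice vector -/
abbrev latt {d : ℕ} (γ : Fin d → ℤ) : Eu d :=
  (WithLp.equiv 2 (Fin d → ℝ)).symm (fun i => (γ i : ℝ))

lemma dirW_nonneg {d : ℕ} (v : Dir d) : 0 ≤ dirW v := by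
  rcases v with i | i | i <;> simp [dirW]

lemma dirW_le_one {d : ℕ} (v : Dir d) : dirW v ≤ 1 := by
  rcases v with i | i | i <;> simp [dirW]

lemma symbolDom_unique (d : ℕ) : UniqueDiffOn ℝ (symbolDom d) := by
  apply uniqueDiffOn_convex
  · intro p hp q hq a b ha hb hab i
    have h := (convex_Icc (-Real.pi) Real.pi) (hp i) (hq i) ha hb hab
    simpa using h
  · refine ⟨0, ?_⟩
    rw [mem_interior]
    refine ⟨⋂ i : Fin d, {p : PhSp d | p.1 i ∈ Ioo (-Real.pi) Real.pi}, ?_, ?_, ?_⟩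
    · intro p hp i
      exact Ioo_subset_Icc_self (mem_iInter.1 hp i)
    · apply isOpen_iInter_of_finite
      intro i
      apply isOpen_Ioo.preimage
      fun_prop
    · simp [Real.pi_pos]

/-- directional derivative in the domain -/
def pd {d : ℕ} (v : PhSp d) (f : PhSp d → ℂ) : PhSp d → ℂ :=
  fun p => fderivWithin ℝ f (symbolDom d) p v

section pdlemmas
variable {d : ℕ} {v : PhSp d} {f g : PhSp d → ℂ}

lemma top_ne : ((⊤ : ℕ∞) : WithTop ℕ∞) ≠ 0 := by simp

lemma pd_smooth (v : PhSp d) (hf : ContDiffOn ℝ (⊤ : ℕ∞) f (symbolDom d)) :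
    ContDiffOn ℝ (⊤ : ℕ∞) (pd v f) (symbolDom d) := by
  have h := hf.fderivWithin (m := (⊤ : ℕ∞)) (symbolDom_unique d) (by simp)
  exact h.clm_apply contDiffOn_const

lemma pd_congr (v : PhSp d) (h : EqOn f g (symbolDom d)) : EqOn (pd v f) (pd v g) (symbolDom d) := by
  intro p hp
  simp only [pd]
  rw [fderivWithin_congr h (h hp)]

lemma pd_add (v : PhSp d) (hf : ContDiffOn ℝ (⊤ : ℕ∞) f (symbolDom d))
    (hg : ContDiffOn ℝ (⊤ : ℕ∞) g (symbolDom d)) :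
    EqOn (pd v (fun p => f p + g p)) (fun p => pd v f p + pd v g p) (symbolDom d) := by
  intro p hp
  simp only [pd]
  rw [fderivWithin_fun_add (symbolDom_unique d p hp) (hf.differentiableOn top_ne p hp)
    (hg.differentiableOn top_ne p hp)]
  rfl

lemma pd_mul (v : PhSp d) (hf : ContDiffOn ℝ (⊤ : ℕ∞) f (symbolDom d))
    (hg : ContDiffOn ℝ (⊤ : ℕ∞) g (symbolDom d)) :
    EqOn (pd v (fun p => f p * g p)) (fun p => pd v f p * g p + f p * pd v g p) (symbolDom d) := by
  intro p hp
  simp only [pd]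
  rw [fderivWithin_fun_mul (symbolDom_unique d p hp) (hf.differentiableOn top_ne p hp)
    (hg.differentiableOn top_ne p hp)]
  simp
  ring

lemma pd_const (v : PhSp d) (c : ℂ) : pd v (fun _ => c) = fun _ => 0 := by
  funext p; simp [pd]

lemma pd_inv (v : PhSp d) (hf : ContDiffOn ℝ (⊤ : ℕ∞) f (symbolDom d))
    (h0 : ∀ p ∈ symbolDom d, f p ≠ 0) :
    EqOn (pd v (fun p => (f p)⁻¹)) (fun p => (-1) * pd v f p * ((f p)⁻¹ * (f p)⁻¹)) (symbolDom d) := by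
  intro p hp
  simp only [pd]
  have h1 := (hf.differentiableOn top_ne p hp).hasFDerivWithinAt
  have h2 : HasFDerivAt (fun z : ℂ => z⁻¹) _ (f p) := (hasDerivAt_inv (h0 p hp)).hasFDerivAt.restrictScalars ℝ
  have h3 := (h2.comp_hasFDerivWithinAt p h1).fderivWithin (symbolDom_unique d p hp)
  have h4 : (fun p => (f p)⁻¹) = (fun z : ℂ => z⁻¹) ∘ f := rfl
  rw [h4, h3]
  have := h0 p hp
  simp
  field_simp
  exact Or.inl trivial

lemma pd_comp_clm (v : PhSp d) (A : PhSp d →L[ℝ] Eu d) {g : Eu d → ℂ}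
    (hg : ContDiff ℝ (⊤ : ℕ∞) g) :
    EqOn (pd v (fun p => g (A p))) (fun p => fderiv ℝ g (A p) (A v)) (symbolDom d) := by
  intro p hp
  simp only [pd]
  have h1 := ((hg.differentiable top_ne) (A p)).hasFDerivAt
  have h2 := (h1.comp p A.hasFDerivAt)
  have h3 := h2.hasFDerivWithinAt.fderivWithin (symbolDom_unique d p hp)
  have h4 : (fun p => g (A p)) = g ∘ A := rfl
  rw [h4, h3]; rfl

lemma pd_per (v : PhSp d) {f : PhSp d → ℂ} (τ : Eu d)
    (hf : ∀ p ∈ symbolDom d, f (p.1, p.2.1 + τ, p.2.2) = f p) :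
    ∀ p ∈ symbolDom d, pd v f (p.1, p.2.1 + τ, p.2.2) = pd v f p := by
  intro p hp
  have e : ∀ q : PhSp d, q + ((0, τ, 0) : PhSp d) = (q.1, q.2.1 + τ, q.2.2) := by
    intro q; ext <;> simp
  have h1 : pd v f p = pd v (fun q => f (q + ((0, τ, 0) : PhSp d))) p := by
    refine pd_congr v ?_ hp
    intro q hq
    simp only [e]
    exact (hf q hq).symm
  rw [h1]
  simp only [pd]
  rw [fderivWithin_comp_add_right, e]
  congr 2
  ext q
  rw [Set.mem_vadd_set_iff_neg_vadd_mem]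
  simp [symbolDom]

end pdlemmas

section symn
variable {d : ℕ} {ι : Type*}

/-- zeroth order bound -/
def Bd (m : ℝ) (σ : ι → PhSp d → ℂ) : Prop :=
  ∃ C : ℝ, 0 ≤ C ∧ ∀ s, ∀ p ∈ symbolDom d, ‖σ s p‖ ≤ C * (1 + ‖p.2.2‖) ^ m

/-- symbol bounds for up to `n` derivatives -/
def SymN : ℕ → ℝ → (ι → PhSp d → ℂ) → Prop
  | 0, m, σ => Bd m σ
  | n + 1, m, σ => Bd m σ ∧ ∀ v : Dir d, SymN n (m - dirW v) (fun s => pd (dirV v) (σ s))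

/-- smooth families -/
def Smo (σ : ι → PhSp d → ℂ) : Prop := ∀ s, ContDiffOn ℝ (⊤ : ℕ∞) (σ s) (symbolDom d)

lemma Smo.pd {σ : ι → PhSp d → ℂ} (h : Smo σ) (v : PhSp d) : Smo (fun s => pd v (σ s)) :=
  fun s => pd_smooth v (h s)

lemma one_le_w (x : Eu d) : 1 ≤ 1 + ‖x‖ := by have := norm_nonneg x; linarith

lemma w_pos (x : Eu d) : 0 < 1 + ‖x‖ := by have := norm_nonneg x; linarith

lemma Bd.congr {m : ℝ} {σ τ : ι → PhSp d → ℂ} (h : ∀ s, EqOn (σ s) (τ s) (symbolDom d))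
    (hs : Bd m σ) : Bd m τ := by
  obtain ⟨C, hC, h1⟩ := hs
  exact ⟨C, hC, fun s p hp => by rw [← h s hp]; exact h1 s p hp⟩

lemma Bd.mono {m m' : ℝ} {σ : ι → PhSp d → ℂ} (hm : m ≤ m') (hs : Bd m σ) : Bd m' σ := by
  obtain ⟨C, hC, h1⟩ := hs
  refine ⟨C, hC, fun s p hp => (h1 s p hp).trans ?_⟩
  exact mul_le_mul_of_nonneg_left (Real.rpow_le_rpow_of_exponent_le (one_le_w _) hm) hC

lemma Bd.add {m : ℝ} {σ τ : ι → PhSp d → ℂ} (hs : Bd m σ) (ht : Bd m τ) :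
    Bd m (fun s p => σ s p + τ s p) := by
  obtain ⟨C, hC, h1⟩ := hs
  obtain ⟨C', hC', h1'⟩ := ht
  refine ⟨C + C', by positivity, fun s p hp => (norm_add_le _ _).trans ?_⟩
  have := h1 s p hp
  have := h1' s p hp
  linarith

lemma Bd.mul {m m' : ℝ} {σ τ : ι → PhSp d → ℂ} (hs : Bd m σ) (ht : Bd m' τ) :
    Bd (m + m') (fun s p => σ s p * τ s p) := by
  obtain ⟨C, hC, h1⟩ := hs
  obtain ⟨C', hC', h1'⟩ := ht
  refine ⟨C * C', by positivity, fun s p hp => ?_⟩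
  rw [norm_mul, Real.rpow_add (w_pos _)]
  calc _ ≤ (C * (1 + ‖p.2.2‖) ^ m) * (C' * (1 + ‖p.2.2‖) ^ m') :=
        mul_le_mul (h1 s p hp) (h1' s p hp) (norm_nonneg _) (by have := w_pos p.2.2; positivity)
    _ = _ := by ring

lemma SymN.bd {n : ℕ} {m : ℝ} {σ : ι → PhSp d → ℂ} (h : SymN n m σ) : Bd m σ := by
  cases n with
  | zero => exact h
  | succ n => exact h.1

lemma SymN.congr {n : ℕ} {m : ℝ} {σ τ : ι → PhSp d → ℂ}
    (h : ∀ s, EqOn (σ s) (τ s) (symbolDom d)) (hs : SymN n m σ) : SymN n m τ := by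
  induction n generalizing m σ τ with
  | zero => exact Bd.congr h hs
  | succ n ih => exact ⟨Bd.congr h hs.1, fun v => ih (fun s => pd_congr _ (h s)) (hs.2 v)⟩

lemma SymN.mono {n : ℕ} {m m' : ℝ} {σ : ι → PhSp d → ℂ} (hm : m ≤ m') (hs : SymN n m σ) :
    SymN n m' σ := by
  induction n generalizing m m' σ with
  | zero => exact Bd.mono hm hs
  | succ n ih => exact ⟨Bd.mono hm hs.1, fun v => ih (by linarith) (hs.2 v)⟩

lemma SymN.pred {n : ℕ} {m : ℝ} {σ : ι → PhSp d → ℂ} (hs : SymN (n + 1) m σ) :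
    SymN n m σ := by
  induction n generalizing m σ with
  | zero => exact hs.1
  | succ n ih => exact ⟨hs.1, fun v => ih (hs.2 v)⟩

lemma SymN.reindex {κ : Type*} (e : κ → ι) {n : ℕ} {m : ℝ} {σ : ι → PhSp d → ℂ}
    (hs : SymN n m σ) : SymN n m (fun s => σ (e s)) := by
  induction n generalizing m σ with
  | zero => obtain ⟨C, hC, h⟩ := hs; exact ⟨C, hC, fun s => h (e s)⟩
  | succ n ih =>
    exact ⟨by obtain ⟨C, hC, h⟩ := hs.1; exact ⟨C, hC, fun s => h (e s)⟩, fun v => ih (hs.2 v)⟩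

lemma SymN.add {n : ℕ} {m : ℝ} {σ τ : ι → PhSp d → ℂ} (smσ : Smo σ) (smτ : Smo τ)
    (hs : SymN n m σ) (ht : SymN n m τ) : SymN n m (fun s p => σ s p + τ s p) := by
  induction n generalizing m σ τ with
  | zero => exact Bd.add hs ht
  | succ n ih =>
    refine ⟨Bd.add hs.1 ht.1, fun v => ?_⟩
    exact (ih (smσ.pd _) (smτ.pd _) (hs.2 v) (ht.2 v)).congr
      fun s => (pd_add _ (smσ s) (smτ s)).symm

lemma Smo.mul {σ τ : ι → PhSp d → ℂ} (smσ : Smo σ) (smτ : Smo τ) :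
    Smo (fun s p => σ s p * τ s p) := fun s => (smσ s).mul (smτ s)

lemma Smo.add {σ τ : ι → PhSp d → ℂ} (smσ : Smo σ) (smτ : Smo τ) :
    Smo (fun s p => σ s p + τ s p) := fun s => (smσ s).add (smτ s)

lemma SymN.mul {n : ℕ} {m m' : ℝ} {σ τ : ι → PhSp d → ℂ} (smσ : Smo σ) (smτ : Smo τ)
    (hs : SymN n m σ) (ht : SymN n m' τ) : SymN n (m + m') (fun s p => σ s p * τ s p) := by
  induction n generalizing m m' σ τ with
  | zero => exact Bd.mul hs ht
  | succ n ih =>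
    refine ⟨Bd.mul hs.1 ht.1, fun v => ?_⟩
    have h1 := ih (smσ.pd _) smτ (hs.2 v) ht.pred
    have h2 := ih smσ (smτ.pd _) hs.pred (ht.2 v)
    rw [show m - dirW v + m' = m + m' - dirW v by ring] at h1
    rw [show m + (m' - dirW v) = m + m' - dirW v by ring] at h2
    exact (SymN.add ((smσ.pd _).mul smτ) (smσ.mul (smτ.pd _)) h1 h2).congr
      fun s => (pd_mul _ (smσ s) (smτ s)).symm

lemma SymN.zero (n : ℕ) (m : ℝ) : SymN n m (fun (_ : ι) (_ : PhSp d) => (0 : ℂ)) := by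
  have hb : ∀ m : ℝ, Bd m (fun (_ : ι) (_ : PhSp d) => (0 : ℂ)) := fun m =>
    ⟨0, le_rfl, by intros; simp⟩
  induction n generalizing m with
  | zero => exact hb m
  | succ n ih => exact ⟨hb m, fun v => by simp only [pd_const]; exact ih _⟩

lemma SymN.const (n : ℕ) (c : ℂ) : SymN n 0 (fun (_ : ι) (_ : PhSp d) => c) := by
  have hb : Bd 0 (fun (_ : ι) (_ : PhSp d) => c) := ⟨‖c‖, norm_nonneg _, by intros; simp⟩
  cases n with
  | zero => exact hb
  | succ n => exact ⟨hb, fun v => by simp only [pd_const]; exact SymN.zero _ _⟩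

lemma SymN.inv {m : ℝ} {σ : ι → PhSp d → ℂ} (sm : Smo σ) (h0 : ∀ s, ∀ p ∈ symbolDom d, σ s p ≠ 0)
    (hs : ∀ n, SymN n m σ) (hb : Bd (-m) (fun s p => (σ s p)⁻¹)) (n : ℕ) :
    SymN n (-m) (fun s p => (σ s p)⁻¹) := by
  have smi : Smo (fun s p => (σ s p)⁻¹) := fun s => (sm s).inv (h0 s)
  induction n with
  | zero => exact hb
  | succ n ih =>
    refine ⟨hb, fun v => ?_⟩
    have h1 := SymN.mul (fun s => contDiffOn_const) (sm.pd (dirV v)) (SymN.const n (-1)) ((hs (n+1)).2 v)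
    have h2 := SymN.mul smi smi ih ih
    have h3 := SymN.mul (Smo.mul (fun s => contDiffOn_const) (sm.pd _)) (smi.mul smi) h1 h2
    rw [show 0 + (m - dirW v) + (-m + -m) = -m - dirW v by ring] at h3
    exact h3.congr fun s => (pd_inv _ (sm s) (h0 s)).symm

/-- The full symbol class. -/
structure SymCl (m : ℝ) (σ : ι → PhSp d → ℂ) : Prop where
  smooth : Smo σ
  per : ∀ s, ∀ p ∈ symbolDom d, ∀ γ : Fin d → ℤ, σ s (p.1, p.2.1 + latt γ, p.2.2) = σ s p
  bd : ∀ n, SymN n m σ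

lemma SymCl.congr {m : ℝ} {σ τ : ι → PhSp d → ℂ}
    (h : ∀ s, EqOn (σ s) (τ s) (symbolDom d)) (hs : SymCl m σ) : SymCl m τ where
  smooth s := (hs.smooth s).congr (h s).symm
  per s p hp γ := by
    rw [← h s hp, ← hs.per s p hp γ]
    exact (h s (show (p.1, p.2.1 + latt γ, p.2.2) ∈ symbolDom d from hp)).symm
  bd n := (hs.bd n).congr h

lemma SymCl.mono {m m' : ℝ} {σ : ι → PhSp d → ℂ} (hm : m ≤ m') (hs : SymCl m σ) : SymCl m' σ :=
  ⟨hs.smooth, hs.per, fun n => (hs.bd n).mono hm⟩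

lemma SymCl.reindex {κ : Type*} (e : κ → ι) {m : ℝ} {σ : ι → PhSp d → ℂ} (hs : SymCl m σ) :
    SymCl m (fun s => σ (e s)) :=
  ⟨fun _ => hs.smooth _, fun _ => hs.per _, fun n => (hs.bd n).reindex e⟩

lemma SymCl.add {m : ℝ} {σ τ : ι → PhSp d → ℂ} (hs : SymCl m σ) (ht : SymCl m τ) :
    SymCl m (fun s p => σ s p + τ s p) :=
  ⟨hs.smooth.add ht.smooth, fun s p hp γ => by simp only [hs.per s p hp γ, ht.per s p hp γ],
    fun n => (hs.bd n).add hs.smooth ht.smooth (ht.bd n)⟩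

lemma SymCl.mul {m m' : ℝ} {σ τ : ι → PhSp d → ℂ} (hs : SymCl m σ) (ht : SymCl m' τ) :
    SymCl (m + m') (fun s p => σ s p * τ s p) :=
  ⟨hs.smooth.mul ht.smooth, fun s p hp γ => by simp only [hs.per s p hp γ, ht.per s p hp γ],
    fun n => (hs.bd n).mul hs.smooth ht.smooth (ht.bd n)⟩

lemma SymCl.const (c : ℂ) : SymCl 0 (fun (_ : ι) (_ : PhSp d) => c) :=
  ⟨fun _ => contDiffOn_const, fun _ _ _ _ => rfl, fun n => SymN.const n c⟩

lemma SymCl.zero (m : ℝ) : SymCl m (fun (_ : ι) (_ : PhSp d) => (0 : ℂ)) :=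
  ⟨fun _ => contDiffOn_const, fun _ _ _ _ => rfl, fun n => SymN.zero n m⟩

lemma SymCl.smul {m : ℝ} (c : ℂ) {σ : ι → PhSp d → ℂ} (hs : SymCl m σ) :
    SymCl m (fun s p => c * σ s p) := by
  simpa using (SymCl.const c).mul hs

lemma SymCl.sub {m : ℝ} {σ τ : ι → PhSp d → ℂ} (hs : SymCl m σ) (ht : SymCl m τ) :
    SymCl m (fun s p => σ s p - τ s p) := by
  have := hs.add (ht.smul (-1))
  simpa [sub_eq_add_neg] using this

lemma SymCl.sum {m : ℝ} {α : Type*} (S : Finset α) {σ : α → ι → PhSp d → ℂ}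
    (h : ∀ j ∈ S, SymCl m (σ j)) : SymCl m (fun s p => ∑ j ∈ S, σ j s p) := by
  classical
  induction S using Finset.induction_on with
  | empty => simpa using SymCl.zero m
  | insert j S hj ih =>
    simp only [Finset.sum_insert hj]
    exact (h j (by simp)).add (ih fun i hi => h i (by simp [hi]))

lemma SymCl.inv {m : ℝ} {σ : ι → PhSp d → ℂ} (hs : SymCl m σ)
    (h0 : ∀ s, ∀ p ∈ symbolDom d, σ s p ≠ 0) (hb : Bd (-m) (fun s p => (σ s p)⁻¹)) :
    SymCl (-m) (fun s p => (σ s p)⁻¹) :=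
  ⟨fun s => (hs.smooth s).inv (h0 s), fun s p hp γ => by simp only [hs.per s p hp γ],
    SymN.inv hs.smooth h0 hs.bd hb⟩

lemma SymCl.pd {m : ℝ} {σ : ι → PhSp d → ℂ} (hs : SymCl m σ) (v : Dir d) :
    SymCl (m - dirW v) (fun s => pd (dirV v) (σ s)) :=
  ⟨hs.smooth.pd _, fun s p hp γ => pd_per _ _ (fun q hq => hs.per s q hq γ) p hp,
    fun n => (hs.bd (n+1)).2 v⟩

/-- iterated derivative -/
def ld (L : List (Dir d)) (f : PhSp d → ℂ) : PhSp d → ℂ :=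
  listDerivWithin (symbolDom d) (L.map dirV) f

/-- weight of a list -/
def wt (L : List (Dir d)) : ℝ := (L.map dirW).sum

lemma ld_nil (f : PhSp d → ℂ) : ld [] f = f := rfl

lemma ld_cons (v : Dir d) (L : List (Dir d)) (f : PhSp d → ℂ) :
    ld (v :: L) f = _root_.pd (dirV v) (ld L f) := rfl

lemma SymCl.ld {m : ℝ} {σ : ι → PhSp d → ℂ} (hs : SymCl m σ) (L : List (Dir d)) :
    SymCl (m - wt L) (fun s => ld L (σ s)) := by
  induction L with
  | nil => simpa [wt, ld_nil] using hs
  | cons v L ih =>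
    have := ih.pd v
    rw [show m - wt L - dirW v = m - wt (v :: L) by simp [wt]; ring] at this
    exact this

lemma ld_smooth {f : PhSp d → ℂ} (L : List (Dir d)) (hf : ContDiffOn ℝ (⊤ : ℕ∞) f (symbolDom d)) :
    ContDiffOn ℝ (⊤ : ℕ∞) (ld L f) (symbolDom d) := by
  induction L with
  | nil => exact hf
  | cons v L ih => exact pd_smooth _ ih

lemma ld_congr {f g : PhSp d → ℂ} (L : List (Dir d)) (h : EqOn f g (symbolDom d)) :
    EqOn (ld L f) (ld L g) (symbolDom d) := by
  induction L with
  | nil => exact h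
  | cons v L ih => exact pd_congr _ ih

lemma ld_add {f g : PhSp d → ℂ} (L : List (Dir d)) (hf : ContDiffOn ℝ (⊤ : ℕ∞) f (symbolDom d))
    (hg : ContDiffOn ℝ (⊤ : ℕ∞) g (symbolDom d)) :
    EqOn (ld L (fun p => f p + g p)) (fun p => ld L f p + ld L g p) (symbolDom d) := by
  induction L with
  | nil => intro p _; rfl
  | cons v L ih =>
    exact (pd_congr (dirV v) ih).trans (pd_add _ (ld_smooth L hf) (ld_smooth L hg))

lemma ld_zero (L : List (Dir d)) : ld L (fun _ => (0 : ℂ)) = fun _ => 0 := by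
  induction L with
  | nil => rfl
  | cons v L ih => rw [ld_cons, ih, pd_const]

lemma ld_smul {f : PhSp d → ℂ} (L : List (Dir d)) (c : ℂ) (hf : ContDiffOn ℝ (⊤ : ℕ∞) f (symbolDom d)) :
    EqOn (ld L (fun p => c * f p)) (fun p => c * ld L f p) (symbolDom d) := by
  induction L with
  | nil => intro p _; rfl
  | cons v L ih =>
    refine (pd_congr (dirV v) ih).trans ((pd_mul (dirV v) contDiffOn_const (ld_smooth L hf)).trans ?_)
    intro p _
    simp [pd_const, ld_cons]

lemma ld_sum {α : Type*} (S : Finset α) {f : α → PhSp d → ℂ} (L : List (Dir d))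
    (hf : ∀ j, ContDiffOn ℝ (⊤ : ℕ∞) (f j) (symbolDom d)) :
    EqOn (ld L (fun p => ∑ j ∈ S, f j p)) (fun p => ∑ j ∈ S, ld L (f j) p) (symbolDom d) := by
  classical
  induction S using Finset.induction_on with
  | empty => simp [ld_zero, EqOn]
  | insert j S hj ih =>
    simp only [Finset.sum_insert hj]
    refine (ld_add L (hf j) (ContDiffOn.sum fun i _ => hf i)).trans ?_
    intro p hp
    simp only [ih hp]

/-- locality -/
lemma ld_local {f g : PhSp d → ℂ} (L : List (Dir d)) {U : Set (PhSp d)} (hU : IsOpen U)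
    (h : EqOn f g (symbolDom d ∩ U)) : EqOn (ld L f) (ld L g) (symbolDom d ∩ U) := by
  induction L with
  | nil => exact h
  | cons v L ih =>
    intro p hp
    simp only [ld_cons, _root_.pd]
    rw [Filter.EventuallyEq.fderivWithin_eq _ (ih hp)]
    filter_upwards [inter_mem_nhdsWithin (symbolDom d) (hU.mem_nhds hp.2)] with q hq
    exact ih hq

lemma SymN.of_ld {m : ℝ} {σ : ι → PhSp d → ℂ} (h : ∀ L : List (Dir d), Bd (m - wt L) (fun s => _root_.ld L (σ s)))
    (n : ℕ) : SymN n m σ := by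
  have key : ∀ n (L : List (Dir d)), SymN n (m - wt L) (fun s => _root_.ld L (σ s)) := by
    intro n
    induction n with
    | zero => exact h
    | succ n ih =>
      intro L
      refine ⟨h L, fun v => ?_⟩
      have := ih (v :: L)
      rwa [show m - wt (v :: L) = m - wt L - dirW v by simp [wt]; ring] at this
  simpa [wt, ld_nil] using key n []

lemma SymCl.unif {m : ℝ} {σ : ι → PhSp d → ℂ} (hs : SymCl m σ) (n : ℕ) :
    ∃ C : ℝ, 0 ≤ C ∧ ∀ L : List (Dir d), L.length ≤ n → ∀ s, ∀ p ∈ symbolDom d,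
      ‖_root_.ld L (σ s) p‖ ≤ C * (1 + ‖p.2.2‖) ^ (m - wt L) := by
  have h : ∀ L : List (Dir d), Bd (m - wt L) (fun s => _root_.ld L (σ s)) :=
    fun L => ((hs.ld L).bd 0).bd
  choose C hC hb using h
  obtain ⟨B, hB⟩ := ((List.finite_length_le (Dir d) n).image C).bddAbove
  refine ⟨max B 0, le_max_right _ _, fun L hL s p hp => (hb L s p hp).trans ?_⟩
  have : C L ≤ max B 0 := (hB ⟨L, hL, rfl⟩).trans (le_max_left _ _)
  exact mul_le_mul_of_nonneg_right this (by have := w_pos p.2.2; positivity)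

end symn

section basic
variable {d : ℕ} {ι : Type*}

/-- projection to `x` -/
def px (d : ℕ) : PhSp d →L[ℝ] Eu d :=
  (ContinuousLinearMap.fst ℝ (Eu d) (Eu d)).comp (ContinuousLinearMap.snd ℝ (Eu d) (Eu d × Eu d))

/-- projection to `ξ` -/
def pxi (d : ℕ) : PhSp d →L[ℝ] Eu d :=
  (ContinuousLinearMap.snd ℝ (Eu d) (Eu d)).comp (ContinuousLinearMap.snd ℝ (Eu d) (Eu d × Eu d))

lemma px_apply (p : PhSp d) : px d p = p.2.1 := rfl
lemma pxi_apply (p : PhSp d) : pxi d p = p.2.2 := rfl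

lemma periodic_bdd {g : Eu d → ℂ} (hg : Continuous g) (hp : ∀ x (γ : Fin d → ℤ), g (x + latt γ) = g x) :
    ∃ C : ℝ, 0 ≤ C ∧ ∀ x, ‖g x‖ ≤ C := by
  have hK : IsCompact ((fun y : Fin d → ℝ => (WithLp.toLp 2 y : Eu d)) '' (Set.pi univ fun _ => Icc (0:ℝ) 1)) := by
    apply (isCompact_univ_pi fun _ => isCompact_Icc).image
    fun_prop
  obtain ⟨C, hC⟩ := hK.exists_bound_of_continuousOn hg.continuousOn
  refine ⟨max C 0, le_max_right _ _, fun x => ?_⟩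
  let y : Eu d := WithLp.toLp 2 (fun i => Int.fract (x i))
  have hxy : x = y + latt (fun i => ⌊x i⌋) := by
    ext i
    simp [y, latt]
  rw [hxy, hp]
  refine (hC y ⟨fun i => Int.fract (x i), ?_, rfl⟩).trans (le_max_left _ _)
  intro i _
  exact ⟨Int.fract_nonneg _, (Int.fract_lt_one _).le⟩

lemma fderiv_apply_smooth {g : Eu d → ℂ} (hg : ContDiff ℝ (⊤ : ℕ∞) g) (e : Eu d) :
    ContDiff ℝ (⊤ : ℕ∞) (fun x => fderiv ℝ g x e) :=
  (hg.fderiv_right (m := (⊤ : ℕ∞)) (by simp)).clm_apply contDiff_const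

lemma coef_symN {g : Eu d → ℂ} (hg : ContDiff ℝ (⊤ : ℕ∞) g)
    (hp : ∀ x (γ : Fin d → ℤ), g (x + latt γ) = g x) (n : ℕ) :
    SymN n 0 (fun (_ : ι) (p : PhSp d) => g p.2.1) := by
  induction n generalizing g with
  | zero =>
    obtain ⟨C, hC, h⟩ := periodic_bdd hg.continuous hp
    exact ⟨C, hC, fun s p _ => by simpa using h p.2.1⟩
  | succ n ih =>
    refine ⟨?_, fun v => ?_⟩
    · obtain ⟨C, hC, h⟩ := periodic_bdd hg.continuous hp
      exact ⟨C, hC, fun s p _ => by simpa using h p.2.1⟩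
    · refine SymN.congr (fun s => (pd_comp_clm (dirV v) (px d) hg).symm) ?_
      rcases v with i | i | i
      · simp only [dirV, dirK, px_apply, map_zero]; exact SymN.zero _ _
      · simp only [dirV, dirX, px_apply, dirW, sub_zero]
        refine ih (fderiv_apply_smooth hg _) ?_
        intro x γ
        rw [← fderiv_comp_add_right]
        simp only [hp]
      · simp only [dirV, dirXi, px_apply, map_zero]; exact SymN.zero _ _

lemma coef_sym {g : Eu d → ℂ} (hg : ContDiff ℝ (⊤ : ℕ∞) g)
    (hp : ∀ x (γ : Fin d → ℤ), g (x + latt γ) = g x) :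
    SymCl 0 (fun (_ : ι) (p : PhSp d) => g p.2.1) :=
  ⟨fun _ => (hg.comp (px d).contDiff).contDiffOn, fun _ _ _ _ => hp _ _, coef_symN hg hp⟩

lemma cube_bdd (k : Eu d) (hk : k ∈ symbolCube d) (j : Fin d) : |k j| ≤ Real.pi :=
  abs_le.2 (hk j)

/-- linear functional `ξ_j + k_j` -/
def ell (j : Fin d) : PhSp d →L[ℝ] ℂ :=
  Complex.ofRealCLM.comp ((EuclideanSpace.proj j).comp (pxi d) +
    (EuclideanSpace.proj j).comp (ContinuousLinearMap.fst ℝ (Eu d) (Eu d × Eu d)))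

lemma ell_apply (j : Fin d) (p : PhSp d) : ell j p = (p.2.2 j : ℂ) + (p.1 j : ℂ) := by
  simp [ell, pxi_apply]

lemma coord_le (x : Eu d) (j : Fin d) : |x j| ≤ ‖x‖ := by
  have := PiLp.norm_apply_le x j
  simpa using this

lemma zeta_sym (j : Fin d) (c : ι → ℂ) (B : ℝ) (hc : ∀ s, ‖c s‖ ≤ B) :
    SymCl 1 (fun (s : ι) (p : PhSp d) => (p.2.2 j : ℂ) + (p.1 j : ℂ) + c s) := by
  simp only [← ell_apply]
  have hb : Bd 1 (fun (s : ι) (p : PhSp d) => ell j p + c s) := by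
    refine ⟨1 + Real.pi + |B|, by positivity, fun s p hp => ?_⟩
    simp only [ell_apply, Real.rpow_one]
    have h1 : ‖(p.2.2 j : ℂ)‖ ≤ ‖p.2.2‖ := by
      rw [Complex.norm_real]; exact coord_le _ _
    have h2 : ‖(p.1 j : ℂ)‖ ≤ Real.pi := by
      rw [Complex.norm_real]; exact cube_bdd _ hp j
    have h3 := (hc s).trans (le_abs_self B)
    have h4 := norm_add₃_le (a := (p.2.2 j : ℂ)) (b := (p.1 j : ℂ)) (c := c s)
    have := Real.pi_pos
    have := norm_nonneg p.2.2
    nlinarith [abs_nonneg B]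
  have hpd : ∀ v s, EqOn (pd v (fun p : PhSp d => ell j p + c s)) (fun _ => ell j v) (symbolDom d) := by
    intro v s p hp
    simp only [pd]
    rw [((ell j).hasFDerivAt.add_const (c s)).hasFDerivWithinAt.fderivWithin (symbolDom_unique d p hp)]
  refine ⟨fun s => ((ell j).contDiff.add contDiff_const).contDiffOn, ?_, fun n => ?_⟩
  · intro s p hp γ; simp [ell_apply]
  · cases n with
    | zero => exact hb
    | succ n =>
      refine ⟨hb, fun v => SymN.congr (fun s => (hpd _ s).symm) ?_⟩
      exact (SymN.const n _).mono (by have := dirW_le_one v; linarith)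

/-- parameters in `(0,1]` -/
abbrev Ep := Set.Ioc (0:ℝ) 1

lemma cut_bd {g : Eu d → ℂ} (hg : ContDiff ℝ (⊤ : ℕ∞) g) (R : ℝ) (hR0 : 0 ≤ R)
    (hR : ∀ y, R < ‖y‖ → g y = 0) : ∃ C, 0 ≤ C ∧ ∀ y, ‖g y‖ ≤ C := by
  obtain ⟨C, hC⟩ := (isCompact_closedBall (0 : Eu d) R).exists_bound_of_continuousOn
    hg.continuous.continuousOn
  refine ⟨max C 0, le_max_right _ _, fun y => ?_⟩
  by_cases h : R < ‖y‖
  · simp [hR y h]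
  · exact (hC y (by simpa using h)).trans (le_max_left _ _)

lemma cut_symN {g : Eu d → ℂ} (hg : ContDiff ℝ (⊤ : ℕ∞) g) (R : ℝ) (hR0 : 0 ≤ R)
    (hR : ∀ y, R < ‖y‖ → g y = 0) (w : ℕ) (n : ℕ) :
    SymN n (-(w:ℝ)) (fun (ε : Ep) (p : PhSp d) => ((ε:ℝ):ℂ) ^ w * g ((ε:ℝ) • p.2.2)) := by
  have hb : ∀ {g : Eu d → ℂ} (hg : ContDiff ℝ (⊤ : ℕ∞) g)
    (hR : ∀ y, R < ‖y‖ → g y = 0) (w : ℕ),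
    Bd (-(w:ℝ)) (fun (ε : Ep) (p : PhSp d) => ((ε:ℝ):ℂ) ^ w * g ((ε:ℝ) • p.2.2)) := by
    intro g hg hR w
    obtain ⟨C, hC, h⟩ := cut_bd hg R hR0 hR
    refine ⟨(1 + R) ^ w * C, by positivity, fun ε p _ => ?_⟩
    obtain ⟨ε, he0, he1⟩ := ε
    simp only
    have hw := w_pos p.2.2
    by_cases hy : R < ‖ε • p.2.2‖
    · rw [hR _ hy]; simp only [mul_zero, norm_zero]; positivity
    · rw [norm_smul, Real.norm_of_nonneg he0.le, not_lt] at hy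
      have h1 : ε * (1 + ‖p.2.2‖) ≤ 1 + R := by linarith
      have h2 : ε ^ w ≤ (1 + R) ^ w * (1 + ‖p.2.2‖) ^ (-(w:ℝ)) := by
        rw [Real.rpow_neg hw.le, Real.rpow_natCast, ← div_eq_mul_inv, le_div_iff₀ (by positivity),
          ← mul_pow]
        exact pow_le_pow_left₀ (by positivity) h1 w
      rw [norm_mul, norm_pow, Complex.norm_real, Real.norm_of_nonneg he0.le]
      calc _ ≤ ((1 + R) ^ w * (1 + ‖p.2.2‖) ^ (-(w:ℝ))) * C :=
            mul_le_mul h2 (h _) (norm_nonneg _) (by positivity)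
        _ = _ := by ring
  induction n generalizing g w with
  | zero => exact hb hg hR w
  | succ n ih =>
    refine ⟨hb hg hR w, fun v => ?_⟩
    have hpd : ∀ ε : Ep, EqOn (pd (dirV v) (fun p : PhSp d => ((ε:ℝ):ℂ) ^ w * g ((ε:ℝ) • p.2.2)))
        (fun p => ((ε:ℝ):ℂ) ^ (w+1) * fderiv ℝ g ((ε:ℝ) • p.2.2) (dirV v).2.2) (symbolDom d) := by
      intro ε
      refine (pd_comp_clm (dirV v) ((ε:ℝ) • pxi d) (g := fun y => ((ε:ℝ):ℂ) ^ w * g y)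
        (contDiff_const.mul hg)).trans ?_
      intro p _
      simp only
      rw [fderiv_const_mul (hg.differentiable top_ne _)]
      simp [pxi_apply, pow_succ]
      ring
    refine SymN.congr (fun ε => (hpd ε).symm) ?_
    rcases v with i | i | i
    · simp only [dirV, dirK, map_zero, mul_zero]; exact SymN.zero _ _
    · simp only [dirV, dirX, map_zero, mul_zero]; exact SymN.zero _ _
    · simp only [dirV, dirXi, dirW]
      have := ih (fderiv_apply_smooth hg (EuclideanSpace.single i 1)) (fun y hy => ?_) (w+1)
      · rwa [show -((w+1:ℕ):ℝ) = -(w:ℝ) - 1 by push_cast; ring] at this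
      · have : g =ᶠ[nhds y] fun _ => 0 := by
          filter_upwards [(isOpen_lt continuous_const continuous_norm).mem_nhds hy] with z hz
          exact hR z hz
        rw [this.fderiv_eq]; simp

lemma cut_sym {g : Eu d → ℂ} (hg : ContDiff ℝ (⊤ : ℕ∞) g) (R : ℝ) (hR0 : 0 ≤ R)
    (hR : ∀ y, R < ‖y‖ → g y = 0) (w : ℕ) :
    SymCl (-(w:ℝ)) (fun (ε : Ep) (p : PhSp d) => ((ε:ℝ):ℂ) ^ w * g ((ε:ℝ) • p.2.2)) :=
  ⟨fun ε => (contDiff_const.mul (hg.comp ((ε:ℝ) • pxi d).contDiff)).contDiffOn,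
    fun _ _ _ _ => rfl, cut_symN hg R hR0 hR w⟩

lemma cut_negInf {g : Eu d → ℂ} (hg : ContDiff ℝ (⊤ : ℕ∞) g) (R : ℝ) (hR0 : 0 ≤ R)
    (hR : ∀ y, R < ‖y‖ → g y = 0) (m : ℝ) (ε : Ep) :
    SymCl m (fun (_ : ι) (p : PhSp d) => g ((ε:ℝ) • p.2.2)) := by
  obtain ⟨w, hw⟩ := exists_nat_ge (-m)
  have h := (((cut_sym hg R hR0 hR w).reindex (fun _ : ι => ε)).smul ((((ε:ℝ):ℂ) ^ w)⁻¹)).mono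
    (show -(w:ℝ) ≤ m by linarith)
  refine h.congr fun s p _ => ?_
  have : (((ε:ℝ):ℂ) ^ w) ≠ 0 := pow_ne_zero _ (by exact_mod_cast ε.2.1.ne')
  exact inv_mul_cancel_left₀ this _

lemma cut1_sym {g : Eu d → ℂ} (hg : ContDiff ℝ (⊤ : ℕ∞) g) (R : ℝ) (hR0 : 0 ≤ R)
    (hR : ∀ y, R < ‖y‖ → g y = 0) (h1 : ∀ y, ‖y‖ ≤ 1 → g y = 1) :
    SymCl 1 (fun (ε : Ep) (p : PhSp d) => ((ε:ℝ):ℂ)⁻¹ * (1 - g ((ε:ℝ) • p.2.2))) := by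
  have hb : Bd 1 (fun (ε : Ep) (p : PhSp d) => ((ε:ℝ):ℂ)⁻¹ * (1 - g ((ε:ℝ) • p.2.2))) := by
    obtain ⟨C, hC, h⟩ := cut_bd hg R hR0 hR
    refine ⟨1 + C, by positivity, fun ε p _ => ?_⟩
    obtain ⟨ε, he0, he1⟩ := ε
    simp only
    have hw := w_pos p.2.2
    by_cases hy : ‖ε • p.2.2‖ ≤ 1
    · rw [h1 _ hy]; simp only [sub_self, mul_zero, norm_zero]; positivity
    · rw [norm_smul, Real.norm_of_nonneg he0.le, not_le] at hy
      rw [norm_mul, norm_inv, Complex.norm_real, Real.norm_of_nonneg he0.le, Real.rpow_one, mul_comm]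
      refine mul_le_mul ?_ ?_ (by positivity) (by positivity)
      · refine (norm_sub_le _ _).trans ?_
        have := h (ε • p.2.2)
        simp only [norm_one]; linarith
      · rw [inv_le_iff_one_le_mul₀ he0]; nlinarith
  refine ⟨fun ε => (contDiff_const.mul (contDiff_const.sub (hg.comp ((ε:ℝ) • pxi d).contDiff))).contDiffOn,
    fun _ _ _ _ => rfl, fun n => ?_⟩
  cases n with
  | zero => exact hb
  | succ n =>
    refine ⟨hb, fun v => ?_⟩
    have hpd : ∀ ε : Ep, EqOn (pd (dirV v) (fun p : PhSp d => ((ε:ℝ):ℂ)⁻¹ * (1 - g ((ε:ℝ) • p.2.2))))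
        (fun p => (-1) * (((ε:ℝ):ℂ) ^ 0 * fderiv ℝ g ((ε:ℝ) • p.2.2) (dirV v).2.2)) (symbolDom d) := by
      intro ε
      refine (pd_comp_clm (dirV v) ((ε:ℝ) • pxi d) (g := fun y => ((ε:ℝ):ℂ)⁻¹ * (1 - g y))
        (contDiff_const.mul (contDiff_const.sub hg))).trans ?_
      intro p _
      simp only
      have : ((ε:ℝ):ℂ) ≠ 0 := by exact_mod_cast ε.2.1.ne'
      rw [fderiv_const_mul ((hg.differentiable top_ne _).const_sub 1), fderiv_const_sub]
      simp [pxi_apply]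
      field_simp
    refine SymN.congr (fun ε => (hpd ε).symm) ?_
    rcases v with i | i | i
    · simp only [dirV, dirK, map_zero, mul_zero]; exact SymN.zero _ _
    · simp only [dirV, dirX, map_zero, mul_zero]; exact SymN.zero _ _
    · simp only [dirV, dirXi, dirW]
      have := (cut_sym (fderiv_apply_smooth hg (EuclideanSpace.single i 1)) R hR0 (fun y hy => ?_) 0)
      · have h2 := (this.smul (-1)).bd n
        rwa [show -((0:ℕ):ℝ) = 1 - 1 by simp] at h2
      · have : g =ᶠ[nhds y] fun _ => 0 := by
          filter_upwards [(isOpen_lt continuous_const continuous_norm).mem_nhds hy] with z hz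
          exact hR z hz
        rw [this.fderiv_eq]; simp

/-- a bump function -/
lemma exists_bump (d : ℕ) (r : ℝ) (hr : 0 < r) : ∃ b : Eu d → ℝ, ContDiff ℝ (⊤ : ℕ∞) b ∧
    (∀ y, 0 ≤ b y) ∧ (∀ y, ‖y‖ ≤ r → b y = 1) ∧ (∀ y, 2 * r < ‖y‖ → b y = 0) := by
  let b : ContDiffBump (0 : Eu d) := ⟨r, 2 * r, hr, by linarith⟩
  refine ⟨b, b.contDiff, fun y => b.nonneg, fun y hy => b.one_of_mem_closedBall (by simpa using hy),
    fun y hy => b.zero_of_le_dist (by simpa using hy.le)⟩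

end basic

section borelsum
variable {d : ℕ} {ι : Type*}

/-- The locally finite sum. -/
def bsum (f : ℕ → ι → PhSp d → ℂ) : ι → PhSp d → ℂ :=
  fun s p => ∑ j ∈ Finset.range ⌈‖p.2.2‖⌉₊, f j s p

lemma bsum_eq {f : ℕ → ι → PhSp d → ℂ} (hf : ∀ (j : ℕ) s (p : PhSp d), ‖p.2.2‖ ≤ j → f j s p = 0)
    (J : ℕ) (s : ι) (p : PhSp d) (hJ : ‖p.2.2‖ ≤ J) : bsum f s p = ∑ j ∈ Finset.range J, f j s p := by
  apply Finset.sum_subset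
  · intro j hj
    rw [Finset.mem_range] at *
    exact hj.trans_le (Nat.ceil_le.2 hJ)
  · intro j _ hj
    rw [Finset.mem_range, not_lt, Nat.ceil_le] at hj
    exact hf j s p hj

lemma borel_aux {m : ℝ} (a f : ℕ → ι → PhSp d → ℂ)
    (hfs : ∀ j : ℕ, SymCl (m - j) (f j))
    (hfa : ∀ j (m' : ℝ), SymCl m' (fun s p => f j s p - a j s p))
    (hf0 : ∀ (j : ℕ) s (p : PhSp d), ‖p.2.2‖ ≤ j → f j s p = 0)
    (hfb : ∀ (j : ℕ) (L : List (Dir d)), L.length ≤ j → ∀ s, ∀ p ∈ symbolDom d,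
      ‖ld L (f j s) p‖ ≤ (1/2 : ℝ) ^ j * (1 + ‖p.2.2‖) ^ (1 + (m - j) - wt L))
    (n : ℕ) : SymCl (m - n) (fun s p => bsum f s p - ∑ j ∈ Finset.range n, a j s p) := by
  -- the fixed part
  let B : ℕ → ι → PhSp d → ℂ := fun N s p =>
    (∑ j ∈ Finset.range n, (f j s p - a j s p)) + ∑ j ∈ Finset.Ico n N, f j s p
  have hB : ∀ N, SymCl (m - n) (B N) := by
    intro N
    refine SymCl.add (SymCl.sum _ fun j _ => hfa j _) (SymCl.sum _ fun j hj => (hfs j).mono ?_)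
    have : (n:ℝ) ≤ j := by exact_mod_cast (Finset.mem_Ico.1 hj).1
    linarith
  have hU : ∀ J : ℕ, IsOpen {p : PhSp d | ‖p.2.2‖ < J} := fun J =>
    isOpen_lt (by fun_prop) continuous_const
  have hdec : ∀ (N J : ℕ), n ≤ N → N ≤ J → ∀ s (p : PhSp d), ‖p.2.2‖ < J →
      bsum f s p - ∑ j ∈ Finset.range n, a j s p = B N s p + ∑ j ∈ Finset.Ico N J, f j s p := by
    intro N J hN hJ s p hp
    rw [bsum_eq hf0 J s p hp.le, ← Finset.sum_range_add_sum_Ico _ hJ,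
      ← Finset.sum_range_add_sum_Ico _ hN]
    simp only [B, Finset.sum_sub_distrib]
    ring
  have hex : ∀ (N : ℕ) (p : PhSp d), ∃ J : ℕ, N ≤ J ∧ ‖p.2.2‖ < J := by
    intro N p
    obtain ⟨J, hJ⟩ := exists_nat_gt ‖p.2.2‖
    exact ⟨max N J, le_max_left _ _, hJ.trans_le (by exact_mod_cast le_max_right _ _)⟩
  refine ⟨?_, ?_, SymN.of_ld ?_⟩
  · intro s p hp
    obtain ⟨J, hnJ, hJ⟩ := hex n p
    have h1 : ContDiffOn ℝ (⊤ : ℕ∞) (fun p => B n s p + ∑ j ∈ Finset.Ico n J, f j s p) (symbolDom d) :=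
      ((hB n).smooth s).add (ContDiffOn.sum fun j _ => (hfs j).smooth s)
    refine (h1 p hp).congr_of_eventuallyEq ?_ (hdec n J le_rfl hnJ s p hJ)
    filter_upwards [inter_mem_nhdsWithin (symbolDom d) ((hU J).mem_nhds hJ)] with q hq
    exact hdec n J le_rfl hnJ s q hq.2
  · intro s p hp γ
    obtain ⟨J, hnJ, hJ⟩ := hex n p
    rw [hdec n J le_rfl hnJ s p hJ, hdec n J le_rfl hnJ s (p.1, p.2.1 + latt γ, p.2.2) hJ, (hB n).per s p hp γ]
    simp only [(hfs _).per s p hp γ]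
  · intro L
    let N := max (n + 1) L.length
    have hnN : n + 1 ≤ N := le_max_left _ _
    have hLN : L.length ≤ N := le_max_right _ _
    obtain ⟨C, hC, hCb⟩ := (((hB N).ld L).bd 0).bd
    refine ⟨C + 2, by positivity, fun s p hp => ?_⟩
    obtain ⟨J, hNJ, hJ⟩ := hex N p
    have h1 := ld_local L (hU J) (f := fun p => bsum f s p - ∑ j ∈ Finset.range n, a j s p)
      (g := fun p => B N s p + ∑ j ∈ Finset.Ico N J, f j s p)
      (fun q hq => hdec N J (by omega) hNJ s q hq.2) ⟨hp, hJ⟩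
    have h2 := ld_add L ((hB N).smooth s) (ContDiffOn.sum (s := Finset.Ico N J) fun j _ => (hfs j).smooth s) hp
    have h3 := ld_sum (Finset.Ico N J) L (fun j => (hfs j).smooth s) hp
    simp only at h1 h2 h3
    show ‖ld L (fun p => bsum f s p - ∑ j ∈ Finset.range n, a j s p) p‖ ≤ _
    rw [h1, h2, h3, add_mul]
    refine (norm_add_le _ _).trans (add_le_add (hCb s p hp) ?_)
    have hw := w_pos p.2.2
    calc ‖∑ j ∈ Finset.Ico N J, ld L (f j s) p‖
        ≤ ∑ j ∈ Finset.Ico N J, ‖ld L (f j s) p‖ := norm_sum_le _ _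
      _ ≤ ∑ j ∈ Finset.Ico N J, (1/2 : ℝ) ^ j * (1 + ‖p.2.2‖) ^ (m - n - wt L) := by
        refine Finset.sum_le_sum fun j hj => ?_
        have hj := (Finset.mem_Ico.1 hj).1
        refine (hfb j L (hLN.trans hj) s p hp).trans ?_
        refine mul_le_mul_of_nonneg_left (Real.rpow_le_rpow_of_exponent_le (one_le_w _) ?_) (by positivity)
        have : ((n + 1 : ℕ):ℝ) ≤ j := by exact_mod_cast hnN.trans hj
        push_cast at this
        linarith
      _ = (∑ j ∈ Finset.Ico N J, (1/2 : ℝ) ^ j) * (1 + ‖p.2.2‖) ^ (m - n - wt L) := by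
        rw [Finset.sum_mul]
      _ ≤ 2 * (1 + ‖p.2.2‖) ^ (m - n - wt L) := by
        refine mul_le_mul_of_nonneg_right ?_ (by positivity)
        refine (Finset.sum_le_sum_of_subset_of_nonneg (t := Finset.range J) ?_ ?_).trans
          (sum_geometric_two_le J)
        · intro j hj; rw [Finset.mem_range]; exact (Finset.mem_Ico.1 hj).2
        · intros; positivity

theorem borel_sum {m : ℝ} (a : ℕ → ι → PhSp d → ℂ) (ha : ∀ j : ℕ, SymCl (m - j) (a j)) :
    ∃ A : ι → PhSp d → ℂ, ∀ n : ℕ,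
      SymCl (m - n) (fun s p => A s p - ∑ j ∈ Finset.range n, a j s p) := by
  obtain ⟨b, hb, _, hb1, hb2⟩ := exists_bump d 1 one_pos
  let g : Eu d → ℂ := fun y => (b y : ℂ)
  have hg : ContDiff ℝ (⊤ : ℕ∞) g := Complex.ofRealCLM.contDiff.comp hb
  have hg1 : ∀ y, ‖y‖ ≤ 1 → g y = 1 := fun y hy => by simp [g, hb1 y hy]
  have hg2 : ∀ y, (2 * 1 : ℝ) < ‖y‖ → g y = 0 := fun y hy => by simp [g, hb2 y hy]
  let F : ℕ → ι × Ep → PhSp d → ℂ := fun j s p =>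
    (((s.2:ℝ):ℂ)⁻¹ * (1 - g ((s.2:ℝ) • p.2.2))) * a j s.1 p
  have hF : ∀ j : ℕ, SymCl (1 + (m - j)) (F j) := fun j =>
    ((cut1_sym hg _ (by norm_num) hg2 hg1).reindex Prod.snd).mul ((ha j).reindex Prod.fst)
  choose C hC hCb using fun j => (hF j).unif j
  have hε : ∀ j, (1/2:ℝ) ^ j / (C j + 1) ∈ Ioc (0:ℝ) 1 := by
    intro j
    have := hC j
    refine ⟨by positivity, ?_⟩
    rw [div_le_one (by positivity)]
    exact (pow_le_one₀ (by norm_num) (by norm_num)).trans (by linarith)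
  let ε : ℕ → Ep := fun j => ⟨_, hε j⟩
  have hε0 : ∀ j, ((ε j : ℝ) : ℂ) ≠ 0 := fun j => by exact_mod_cast (ε j).2.1.ne'
  let f : ℕ → ι → PhSp d → ℂ := fun j s p => ((ε j:ℝ):ℂ) * F j (s, ε j) p
  have hfeq : ∀ j s p, f j s p = (1 - g ((ε j:ℝ) • p.2.2)) * a j s p := by
    intro j s p
    simp only [f, F]
    have := hε0 j
    field_simp
  have hfa : ∀ j (m' : ℝ), SymCl m' (fun s p => f j s p - a j s p) := by
    intro j m'
    have h1 := (cut_negInf (ι := ι) hg _ (by norm_num) hg2 (m' - (m - j)) (ε j)).mul ((ha j).smul (-1))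
    rw [sub_add_cancel] at h1
    refine h1.congr fun s p _ => ?_
    simp only [hfeq]; ring
  have hfs : ∀ j : ℕ, SymCl (m - j) (f j) := by
    intro j
    refine ((hfa j (m - j)).add (ha j)).congr fun s p _ => ?_
    simp
  refine ⟨bsum f, borel_aux a f hfs hfa ?_ ?_⟩
  · intro j s p hp
    rw [hfeq, hg1, sub_self, zero_mul]
    rw [norm_smul, Real.norm_of_nonneg (ε j).2.1.le]
    have hC' := hC j
    have h1 : (ε j : ℝ) ≤ (1/2:ℝ) ^ j := div_le_self (by positivity) (by linarith)
    have h2 : ‖p.2.2‖ ≤ 2 ^ j := hp.trans (by exact_mod_cast (Nat.lt_two_pow_self).le)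
    calc (ε j : ℝ) * ‖p.2.2‖ ≤ (1/2:ℝ) ^ j * 2 ^ j := mul_le_mul h1 h2 (norm_nonneg _) (by positivity)
      _ = 1 := by rw [← mul_pow]; norm_num
  · intro j L hL s p hp
    have h1 := ld_smul L ((ε j:ℝ):ℂ) ((hF j).smooth (s, ε j)) hp
    simp only at h1
    have h2 : ld L (f j s) p = _ := h1
    rw [h2, norm_mul, Complex.norm_real, Real.norm_of_nonneg (ε j).2.1.le]
    have hw := w_pos p.2.2
    have hC' := hC j
    calc _ ≤ (ε j : ℝ) * (C j * (1 + ‖p.2.2‖) ^ (1 + (m - j) - wt L)) :=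
          mul_le_mul_of_nonneg_left (hCb j L hL _ p hp) (ε j).2.1.le
      _ = ((ε j : ℝ) * C j) * (1 + ‖p.2.2‖) ^ (1 + (m - j) - wt L) := by ring
      _ ≤ _ := by
        refine mul_le_mul_of_nonneg_right ?_ (by positivity)
        show (1/2:ℝ) ^ j / (C j + 1) * C j ≤ _
        rw [div_mul_eq_mul_div, div_le_iff₀ (by positivity)]
        refine mul_le_mul_of_nonneg_left (by linarith) (by positivity)

end borelsum

section final
variable {d : ℕ}

/-- the index sphere -/
abbrev Sph (d : ℕ) := Metric.sphere (0 : EuclideanSpace ℝ (Fin d)) 1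

/-- x directions list -/
def lx (L : List (Fin d)) : List (Dir d) := L.map fun i => Sum.inr (Sum.inl i)
/-- ξ directions list -/
def lxi (L : List (Fin d)) : List (Dir d) := L.map fun i => Sum.inr (Sum.inr i)
/-- k directions list -/
def lk (L : List (Fin d)) : List (Dir d) := L.map fun i => Sum.inl i

lemma lx_map (L : List (Fin d)) : (lx L).map dirV = L.map (dirX d) := by
  simp [lx, Function.comp_def, dirV]
lemma lxi_map (L : List (Fin d)) : (lxi L).map dirV = L.map (dirXi d) := by
  simp [lxi, Function.comp_def, dirV]
lemma lk_map (L : List (Fin d)) : (lk L).map dirV = L.map (dirK d) := by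
  simp [lk, Function.comp_def, dirV]
lemma wt_lx (L : List (Fin d)) : wt (lx L) = 0 := by
  simp [wt, lx, Function.comp_def, dirW]
lemma wt_lxi (L : List (Fin d)) : wt (lxi L) = L.length := by
  simp [wt, lxi, Function.comp_def, dirW]
lemma wt_lk (L : List (Fin d)) : wt (lk L) = L.length := by
  simp [wt, lk, Function.comp_def, dirW]
lemma wt_append (L L' : List (Dir d)) : wt (L ++ L') = wt L + wt L' := by simp [wt]

lemma SymCl.isSymbol {m : ℝ} {σ : Sph d → PhSp d → ℂ} (h : SymCl m σ) : IsSymbol d m σ := by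
  refine ⟨h.smooth, h.per, fun Lk Lx Lξ => ?_⟩
  obtain ⟨C, _, hC⟩ := ((h.ld (lk Lk ++ lx Lx ++ lxi Lξ)).bd 0).bd
  refine ⟨C, fun s p hp => ?_⟩
  have h1 := hC s p hp
  rw [wt_append, wt_append, wt_lk, wt_lx, wt_lxi] at h1
  simp only [_root_.ld, List.map_append, lk_map, lx_map, lxi_map] at h1
  rw [show m - (Lk.length:ℝ) - Lξ.length = m - (Lk.length + 0 + Lξ.length) by ring]
  exact h1

/-- one term of the composition -/
def cterm (P a : Sph d → PhSp d → ℂ) (β : Fin d → Fin 3) : Sph d → PhSp d → ℂ := fun s p =>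
  (((∏ i, Nat.factorial (β i : ℕ) : ℕ) : ℂ))⁻¹ * ld (lxi (multiList β)) (P s) p *
    ld (lx (multiList β)) (a s) p

lemma compose_eq (P a : Sph d → PhSp d → ℂ) (s : Sph d) (p : PhSp d) :
    composeSym d 2 P a s p = ∑ β ∈ multiIdxSet d 2, cterm P a β s p := by
  simp only [composeSym, cterm, ld, lx_map, lxi_map]

/-- lower order part -/
def Nop (P a : Sph d → PhSp d → ℂ) : Sph d → PhSp d → ℂ := fun s p =>
  ∑ β ∈ (multiIdxSet d 2).erase 0, cterm P a β s p

lemma compose_split (P a : Sph d → PhSp d → ℂ) (s : Sph d) (p : PhSp d) :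
    composeSym d 2 P a s p = P s p * a s p + Nop P a s p := by
  rw [compose_eq, Nop, ← Finset.add_sum_erase (a := (0 : Fin d → Fin 3))]
  · congr 1
    have : multiList (0 : Fin d → Fin 3) = [] := by simp [multiList]
    simp [cterm, this, lx, lxi, ld_nil]
  · simp [multiIdxSet]

lemma Nop_sym {m : ℝ} {P a : Sph d → PhSp d → ℂ} (hP : SymCl 2 P) (ha : SymCl m a) :
    SymCl (m + 1) (Nop P a) := by
  refine SymCl.sum _ fun β hβ => ?_
  have hβ0 : β ≠ 0 := (Finset.mem_erase.1 hβ).1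
  obtain ⟨i, hi⟩ := Function.ne_iff.1 hβ0
  have hlen : 1 ≤ (multiList β).length := by
    apply List.length_pos_of_mem (a := i)
    rw [multiList, List.mem_flatMap]
    refine ⟨i, by simp, ?_⟩
    rw [List.mem_replicate]
    refine ⟨fun h => hi (Fin.ext (by simpa using h)), rfl⟩
  have h1 := ((hP.ld (lxi (multiList β))).smul
    (((∏ i, Nat.factorial (β i : ℕ) : ℕ) : ℂ))⁻¹).mul (ha.ld (lx (multiList β)))
  refine h1.mono ?_
  rw [wt_lx, wt_lxi]
  have : (1:ℝ) ≤ (multiList β).length := by exact_mod_cast hlen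
  linarith

lemma compose_add {P a b : Sph d → PhSp d → ℂ} (ha : Smo a) (hb : Smo b) (s : Sph d) {p : PhSp d}
    (hp : p ∈ symbolDom d) : composeSym d 2 P (fun s p => a s p + b s p) s p =
      composeSym d 2 P a s p + composeSym d 2 P b s p := by
  simp only [compose_eq, ← Finset.sum_add_distrib]
  refine Finset.sum_congr rfl fun β _ => ?_
  simp only [cterm]
  rw [ld_add _ (ha s) (hb s) hp]
  ring

/-- the recursive terms -/
def aseq (P G : Sph d → PhSp d → ℂ) : ℕ → Sph d → PhSp d → ℂ
  | 0 => fun s p => (G s p)⁻¹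
  | j + 1 => fun s p => (-1) * ((G s p)⁻¹ * Nop P (aseq P G j) s p)

theorem parametrix {P φ : Sph d → PhSp d → ℂ} (hP : SymCl 2 P) (hφ : ∀ m, SymCl m φ)
    (h0 : ∀ s, ∀ p ∈ symbolDom d, P s p + φ s p ≠ 0)
    (hb : Bd (-2) (fun s p => (P s p + φ s p)⁻¹)) :
    ∃ a r : Sph d → PhSp d → ℂ, SymCl (-2) a ∧ (∀ m, SymCl m r) ∧
      ∀ s, ∀ p ∈ symbolDom d, composeSym d 2 P a s p = 1 - r s p := by
  let G : Sph d → PhSp d → ℂ := fun s p => P s p + φ s p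
  have hGi : SymCl (-2) (fun s p => (G s p)⁻¹) := (hP.add (hφ 2)).inv h0 hb
  have hseq : ∀ j : ℕ, SymCl (-2 - j) (aseq P G j) := by
    intro j
    induction j with
    | zero => simpa [aseq] using hGi
    | succ j ih =>
      refine ((hGi.mul (Nop_sym hP ih)).smul (-1)).mono ?_
      push_cast; linarith
  let S : ℕ → Sph d → PhSp d → ℂ := fun n s p => ∑ j ∈ Finset.range n, aseq P G j s p
  have hS : ∀ n, SymCl (-2) (S n) := fun n => SymCl.sum _ fun j _ => (hseq j).mono (by
    have : (0:ℝ) ≤ j := Nat.cast_nonneg j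
    linarith)
  have hone : ∀ (j : ℕ) s, ∀ p ∈ symbolDom d, composeSym d 2 P (aseq P G j) s p =
      G s p * aseq P G j s p + Nop P (aseq P G j) s p - φ s p * aseq P G j s p := by
    intro j s p _
    rw [compose_split]; simp only [G]; ring
  have hT : ∀ (n : ℕ) s, ∀ p ∈ symbolDom d, composeSym d 2 P (S (n + 1)) s p =
      1 + Nop P (aseq P G n) s p - φ s p * S (n + 1) s p := by
    intro n
    induction n with
    | zero =>
      intro s p hp
      have : S (0 + 1) = aseq P G 0 := by funext s p; simp [S]
      rw [this, hone 0 s p hp]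
      have hG : G s p ≠ 0 := h0 s p hp
      simp only [aseq]
      rw [mul_inv_cancel₀ hG]
    | succ n ih =>
      intro s p hp
      have e : S (n + 1 + 1) = fun s p => S (n + 1) s p + aseq P G (n + 1) s p := by
        funext s p; simp only [S]; rw [Finset.sum_range_succ]
      rw [e, compose_add (hS _).smooth (hseq _).smooth s hp, ih s p hp, hone _ s p hp]
      have hG : G s p ≠ 0 := h0 s p hp
      have : G s p * aseq P G (n + 1) s p = - Nop P (aseq P G n) s p := by
        simp only [aseq]; field_simp
      rw [this]; ring
  obtain ⟨a, ha⟩ := borel_sum (aseq P G) hseq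
  have ha0 : SymCl (-2) a := by simpa using ha 0
  refine ⟨a, fun s p => 1 - composeSym d 2 P a s p, ha0, fun m => ?_, fun s p _ => by ring⟩
  obtain ⟨n, hn⟩ := exists_nat_ge (-m)
  let R : Sph d → PhSp d → ℂ := fun s p => a s p - S (n + 1) s p
  have hR : SymCl (-2 - ((n + 1 : ℕ):ℝ)) R := ha (n + 1)
  have hTR : SymCl m (fun s p => composeSym d 2 P R s p) := by
    simp only [compose_split]
    refine SymCl.add ((hP.mul hR).mono ?_) ((Nop_sym hP hR).mono ?_) <;> push_cast <;> linarith
  have hN : SymCl m (Nop P (aseq P G n)) := (Nop_sym hP (hseq n)).mono (by linarith)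
  have hφS : SymCl m (fun s p => φ s p * S (n + 1) s p) :=
    ((hφ (m + 2)).mul (hS (n + 1))).mono (by linarith)
  refine ((hφS.sub hN).sub hTR).congr fun s p hp => ?_
  have e : a = fun s p => S (n + 1) s p + R s p := by funext s p; simp [R]
  have h1 : composeSym d 2 P a s p = composeSym d 2 P (S (n + 1)) s p + composeSym d 2 P R s p := by
    conv_lhs => rw [e]
    exact compose_add (hS _).smooth hR.smooth s hp
  show _ = 1 - composeSym d 2 P a s p
  rw [h1, hT n s p hp]
  ring

end final

section elliptic
variable {d : ℕ}

lemma quad_re (A : Fin d → Fin d → ℝ) (η b : Fin d → ℝ) :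
    (∑ j, ∑ l, (A j l : ℂ) * ((η j : ℂ) + Complex.I * (b j : ℂ)) * ((η l : ℂ) + Complex.I * (b l : ℂ))).re
      = (∑ j, ∑ l, A j l * η j * η l) - ∑ j, ∑ l, A j l * b j * b l := by
  simp only [Complex.re_sum, ← Finset.sum_sub_distrib]
  refine Finset.sum_congr rfl fun j _ => Finset.sum_congr rfl fun l _ => ?_
  simp

/-- principal part -/
def Qs (a : Fin d → Fin d → Eu d → ℝ) (βmap : Sph d → Eu d) : Sph d → PhSp d → ℂ := fun s p =>
  ∑ j, ∑ l, (a j l p.2.1 : ℂ) *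
        ((p.2.2 j : ℂ) + (p.1 j : ℂ) + Complex.I * (βmap s j : ℂ)) *
        ((p.2.2 l : ℂ) + (p.1 l : ℂ) + Complex.I * (βmap s l : ℂ))

/-- lower order part -/
def Ls (a : Fin d → Fin d → Eu d → ℝ) (V : Eu d → ℝ) (βmap : Sph d → Eu d) (lam : ℂ) :
    Sph d → PhSp d → ℂ := fun s p =>
  (∑ j, ∑ l, (-Complex.I * (fderiv ℝ (a j l) p.2.1 (EuclideanSpace.single j 1) : ℂ)) *
        ((p.2.2 l : ℂ) + (p.1 l : ℂ) + Complex.I * (βmap s l : ℂ))) + ((V p.2.1 : ℂ) - lam)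

lemma LSym_eq (a : Fin d → Fin d → Eu d → ℝ) (V : Eu d → ℝ) (βmap : Sph d → Eu d) (lam : ℂ) :
    LSym d a V βmap lam = fun s p => Qs a βmap s p + Ls a V βmap lam s p := by
  funext s p
  simp only [LSym, Qs, Ls]
  ring

lemma elliptic_arith {θ K C1 C2 x e q r : ℝ} (hθ : 0 < θ) (hx : 0 ≤ x) (he : 0 ≤ e)
    (hK : 0 ≤ K) (hxe : x ≤ e + K)
    (hq : θ * e ^ 2 - C1 ≤ q) (hr : |r| ≤ C2 * (1 + x)) :
    θ / 8 * (1 + x) ^ 2 - (C1 + θ * (1 / 2 + K ^ 2) + 2 * C2 ^ 2 / θ) ≤ q + r := by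
  have h1 := (abs_le.1 hr).1
  have h2 : x ^ 2 ≤ 2 * e ^ 2 + 2 * K ^ 2 := by
    have : x ^ 2 ≤ (e + K) ^ 2 := pow_le_pow_left₀ hx hxe 2
    nlinarith [sq_nonneg (e - K)]
  have h3 : (1 + x) ^ 2 ≤ 2 + 2 * x ^ 2 := by nlinarith [sq_nonneg (x - 1)]
  have h4 : (1 + x) ^ 2 / 4 - 1 / 2 - K ^ 2 ≤ e ^ 2 := by linarith
  have h5 : θ * ((1 + x) ^ 2 / 4 - 1 / 2 - K ^ 2) ≤ θ * e ^ 2 := mul_le_mul_of_nonneg_left h4 hθ.le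
  have h6 : C2 * (1 + x) ≤ θ / 8 * (1 + x) ^ 2 + 2 * C2 ^ 2 / θ := by
    have : θ / 8 * (1 + x) ^ 2 + 2 * C2 ^ 2 / θ - C2 * (1 + x) = (θ * (1 + x) - 4 * C2) ^ 2 / (8 * θ) := by
      field_simp; ring
    have : 0 ≤ (θ * (1 + x) - 4 * C2) ^ 2 / (8 * θ) := by positivity
    linarith
  nlinarith

end elliptic
/-- inversion/parametrix at the symbol level: there exist `a ∈ S̃^{-2}` and
`r ∈ S̃^{-∞}` with `ℒ∘a = 1 - r` on `𝕊^{d-1} × [-π,π]^d × ℝ^d × ℝ^d`. -/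
theorem stmt_11 (d : ℕ) (hd : 1 ≤ d)
    (a : Fin d → Fin d → EuclideanSpace ℝ (Fin d) → ℝ)
    (V : EuclideanSpace ℝ (Fin d) → ℝ)
    (ha_symm : ∀ j l, a j l = a l j)
    (ha_smooth : ∀ j l, ContDiff ℝ (⊤ : ℕ∞) (a j l)) (hV_smooth : ContDiff ℝ (⊤ : ℕ∞) V)
    (ha_per : ∀ j l (x : EuclideanSpace ℝ (Fin d)) (γ : Fin d → ℤ),
      a j l (x + (WithLp.equiv 2 (Fin d → ℝ)).symm (fun i => (γ i : ℝ))) = a j l x)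
    (hV_per : ∀ (x : EuclideanSpace ℝ (Fin d)) (γ : Fin d → ℤ),
      V (x + (WithLp.equiv 2 (Fin d → ℝ)).symm (fun i => (γ i : ℝ))) = V x)
    (θ : ℝ) (hθ : 0 < θ)
    (hell : ∀ (x ξ : EuclideanSpace ℝ (Fin d)), θ * ‖ξ‖ ^ 2 ≤ ∑ j, ∑ l, a j l x * ξ j * ξ l)
    (βmap : Metric.sphere (0 : EuclideanSpace ℝ (Fin d)) 1 → EuclideanSpace ℝ (Fin d))
    (hβ : Continuous βmap) (lam : ℂ) :
    ∃ asym rsym : Metric.sphere (0 : EuclideanSpace ℝ (Fin d)) 1 → PhSp d → ℂ,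
      IsSymbol d (-2) asym ∧ (∀ m : ℝ, IsSymbol d m rsym) ∧
      ∀ s, ∀ p ∈ symbolDom d,
        composeSym d 2 (LSym d a V βmap lam) asym s p = 1 - rsym s p := by
  -- coefficients are symbols of order 0
  have hreal : ∀ {g : Eu d → ℝ}, ContDiff ℝ (⊤ : ℕ∞) g → ContDiff ℝ (⊤ : ℕ∞) (fun x => (g x : ℂ)) :=
    fun hg => Complex.ofRealCLM.contDiff.comp hg
  have hA : ∀ j l, SymCl 0 (fun (_ : Sph d) (p : PhSp d) => (a j l p.2.1 : ℂ)) := fun j l =>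
    coef_sym (g := fun x => (a j l x : ℂ)) (hreal (ha_smooth j l)) fun x γ => by
      simp only [latt, ha_per]
  have hV : SymCl 0 (fun (_ : Sph d) (p : PhSp d) => (V p.2.1 : ℂ)) :=
    coef_sym (g := fun x => (V x : ℂ)) (hreal hV_smooth) fun x γ => by
      simp only [latt, hV_per]
  have hdA : ∀ j l, SymCl 0 (fun (_ : Sph d) (p : PhSp d) =>
      (fderiv ℝ (a j l) p.2.1 (EuclideanSpace.single j 1) : ℂ)) := fun j l => by
    refine coef_sym (g := fun x => ((fderiv ℝ (a j l) x (EuclideanSpace.single j 1) : ℝ) : ℂ))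
      (hreal ?_) fun x γ => ?_
    · exact ((ha_smooth j l).fderiv_right (m := (⊤ : ℕ∞)) (by simp)).clm_apply contDiff_const
    · rw [← fderiv_comp_add_right]
      simp only [latt, ha_per]
  -- the zeta's
  obtain ⟨B, hB⟩ := (isCompact_range hβ).isBounded.exists_norm_le
  have hBs : ∀ s, ‖βmap s‖ ≤ B := fun s => hB _ ⟨s, rfl⟩
  have hBj : ∀ s j, |βmap s j| ≤ B := fun s j => (coord_le _ _).trans (hBs s)
  have hζ : ∀ j, SymCl 1 (fun (s : Sph d) (p : PhSp d) =>
      (p.2.2 j : ℂ) + (p.1 j : ℂ) + Complex.I * (βmap s j : ℂ)) := fun j =>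
    zeta_sym j (fun s => Complex.I * (βmap s j : ℂ)) B fun s => by
      simpa using hBj s j
  have hQ : SymCl 2 (Qs a βmap) := by
    refine SymCl.sum _ fun j _ => SymCl.sum _ fun l _ => ?_
    exact (((hA j l).mul (hζ j)).mul (hζ l)).mono (by norm_num)
  have hLs : SymCl 1 (Ls a V βmap lam) := by
    refine SymCl.add (SymCl.sum _ fun j _ => SymCl.sum _ fun l _ => ?_) ?_
    · exact (((hdA j l).smul (-Complex.I)).mul (hζ l)).mono (by norm_num)
    · exact (hV.sub (SymCl.const lam)).mono (by norm_num)
  have hL : SymCl 2 (LSym d a V βmap lam) := by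
    rw [LSym_eq]
    exact hQ.add (hLs.mono (by norm_num))
  -- lower bound of the real part
  obtain ⟨C2, hC2, hC2b⟩ := (hLs.bd 0).bd
  have hab : ∀ j l, ∃ C : ℝ, 0 ≤ C ∧ ∀ x, ‖(a j l x : ℂ)‖ ≤ C := fun j l =>
    periodic_bdd (g := fun x => (a j l x : ℂ)) (hreal (ha_smooth j l)).continuous fun x γ => by
      simp only [latt, ha_per]
  choose Ca hCa hCab using hab
  let C1 : ℝ := ∑ j, ∑ l, Ca j l * |B| * |B|
  have hC1 : ∀ s x, ∑ j, ∑ l, a j l x * βmap s j * βmap s l ≤ C1 := by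
    intro s x
    refine Finset.sum_le_sum fun j _ => Finset.sum_le_sum fun l _ => ?_
    refine (le_abs_self _).trans ?_
    rw [abs_mul, abs_mul]
    have h1 : |a j l x| ≤ Ca j l := by simpa using hCab j l x
    have h2 := (hBj s j).trans (le_abs_self B)
    have h3 := (hBj s l).trans (le_abs_self B)
    have := hCa j l
    gcongr
  let K : ℝ := √(∑ _i : Fin d, Real.pi ^ 2)
  have hK : ∀ k ∈ symbolCube d, ‖k‖ ≤ K := by
    intro k hk
    rw [EuclideanSpace.norm_eq]
    refine Real.sqrt_le_sqrt (Finset.sum_le_sum fun i _ => ?_)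
    have := cube_bdd k hk i
    rw [Real.norm_eq_abs]
    gcongr
  let C4 : ℝ := C1 + θ * (1 / 2 + K ^ 2) + 2 * C2 ^ 2 / θ
  have hre : ∀ s, ∀ p ∈ symbolDom d,
      θ / 8 * (1 + ‖p.2.2‖) ^ 2 - C4 ≤ (LSym d a V βmap lam s p).re := by
    intro s p hp
    rw [LSym_eq]
    simp only [Complex.add_re]
    refine elliptic_arith (e := ‖p.2.2 + p.1‖) hθ (norm_nonneg _) (norm_nonneg _)
      (Real.sqrt_nonneg _) ?_ ?_ ?_
    · have h1 := norm_sub_le (p.2.2 + p.1) p.1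
      rw [add_sub_cancel_right] at h1
      linarith [hK p.1 hp]
    · have h1 := hell p.2.1 (p.2.2 + p.1)
      have h2 := quad_re (fun j l => a j l p.2.1) (p.2.2 + p.1) (βmap s)
      have h3 : (Qs a βmap s p).re = (∑ j, ∑ l, a j l p.2.1 * (p.2.2 + p.1) j * (p.2.2 + p.1) l)
          - ∑ j, ∑ l, a j l p.2.1 * βmap s j * βmap s l := by
        refine Eq.trans ?_ h2
        simp only [Qs, Pi.add_apply, Complex.ofReal_add]
      rw [h3]
      have h4 := hC1 s p.2.1
      linarith
    · refine (Complex.abs_re_le_norm _).trans ?_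
      have := hC2b s p hp
      rwa [Real.rpow_one] at this
  -- the cutoff
  have hc : 0 < θ / 8 := by positivity
  obtain ⟨R, hR0, hR⟩ : ∃ R : ℝ, 0 < R ∧ |C4| ≤ θ / 16 * R ^ 2 := by
    refine ⟨1 + 16 * |C4| / θ, by positivity, ?_⟩
    have h1 : 0 ≤ 16 * |C4| / θ := by positivity
    have h2 : |C4| = θ / 16 * (16 * |C4| / θ) := by field_simp
    calc |C4| = θ / 16 * (16 * |C4| / θ) := h2
      _ ≤ _ := by
        refine mul_le_mul_of_nonneg_left ?_ (by positivity)
        nlinarith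
  obtain ⟨b, hb, hb0, hb1, hb2⟩ := exists_bump d R hR0
  let φ : Sph d → PhSp d → ℂ := fun _ p => ((|C4| * b p.2.2 : ℝ) : ℂ)
  have hφ : ∀ m, SymCl m φ := by
    intro m
    have h := cut_negInf (ι := Sph d) (g := fun y => ((|C4| * b y : ℝ) : ℂ))
      (hreal (contDiff_const.mul hb)) (2 * R) (by positivity) (fun y hy => by simp [hb2 y hy]) m
      ⟨1, by norm_num, le_rfl⟩
    simpa [φ] using h
  have hlow : ∀ s, ∀ p ∈ symbolDom d,
      θ / 16 * (1 + ‖p.2.2‖) ^ 2 ≤ ‖LSym d a V βmap lam s p + φ s p‖ := by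
    intro s p hp
    refine le_trans ?_ (Complex.re_le_norm _)
    have h1 := hre s p hp
    have h2 : (φ s p).re = |C4| * b p.2.2 := Complex.ofReal_re _
    rw [Complex.add_re, h2]
    have h3 := le_abs_self C4
    have hx := norm_nonneg p.2.2
    have h6 : 0 ≤ θ / 16 * (1 + ‖p.2.2‖) ^ 2 := by positivity
    rcases le_total ‖p.2.2‖ R with h | h
    · rw [hb1 _ h]; linarith
    · have h4 : 0 ≤ |C4| * b p.2.2 := mul_nonneg (abs_nonneg _) (hb0 _)
      have h5 : θ / 16 * R ^ 2 ≤ θ / 16 * (1 + ‖p.2.2‖) ^ 2 := by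
        gcongr; linarith
      linarith
  have hpos : ∀ p : PhSp d, 0 < θ / 16 * (1 + ‖p.2.2‖) ^ 2 := fun p => by
    have := w_pos p.2.2
    positivity
  obtain ⟨asym, rsym, h1, h2, h3⟩ := parametrix hL hφ
    (fun s p hp => norm_pos_iff.1 ((hpos p).trans_le (hlow s p hp)))
    ⟨(θ / 16)⁻¹, by positivity, fun s p hp => by
      have hw := w_pos p.2.2
      rw [norm_inv, Real.rpow_neg hw.le, ← mul_inv]
      have := hlow s p hp
      have := hpos p
      rw [show (2:ℝ) = ((2:ℕ):ℝ) by norm_num, Real.rpow_natCast]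
      gcongr⟩
  exact ⟨asym, rsym, h1.isSymbol, fun m => (h2 m).isSymbol, h3⟩

end
end

section
/- (Weierstrass preparation, simple-zero case) Let f(t, z) be an analytic (holomorphic) function of (t, z) ∈ ℂ × ℂ^n on a neighborhood of (0,0), with f(0,0) = 0 and ∂f/∂t(0,0) ≠ 0. Then there exist a neighborhood of 0 in ℂ^n, a neighborhood of (0,0) in ℂ^{1+n}, and analytic functions A and B on them respectively, such that f(t, z) = (t − A(z)) B(t, z) on the latter neighborhood, with A(0) = 0 and B(0,0) ≠ 0; moreover the factorization is unique, in the sense that any two such pairs (A, B) agree on a neighborhood of 0 and of (0,0) respectively. -/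
open Filter
open scoped Topology

section helpers
variable {H : Type*} [NormedAddCommGroup H] [NormedSpace ℂ H]

theorem aux_fderiv_continuousAt [ProperSpace H] {T : Type*} [TopologicalSpace T] {g : T → H → ℂ}
    {S : Set T} {t₀ : T} (hS : S ∈ 𝓝 t₀) {x₀ : H} {r : ℝ} (hr : 0 < r)
    (hc : ContinuousOn (Function.uncurry g) (S ×ˢ Metric.closedBall x₀ r))
    (hd : ∀ t ∈ S, DifferentiableOn ℂ (g t) (Metric.ball x₀ r)) :
    ContinuousAt (fun t => fderiv ℂ (g t) x₀) t₀ := by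
  have ht₀ : t₀ ∈ S := mem_of_mem_nhds hS
  have hx : Metric.ball x₀ r ∈ 𝓝 x₀ := Metric.ball_mem_nhds _ hr
  rw [ContinuousAt, Metric.tendsto_nhds]
  intro ε hε
  have hε' : 0 < ε * r / 4 := by positivity
  obtain ⟨v, hv, hv'⟩ := (isCompact_closedBall x₀ r).mem_uniformity_of_prod hc ht₀
    (Metric.dist_mem_uniformity hε')
  rw [nhdsWithin_eq_nhds.2 hS] at hv
  filter_upwards [hv, hS] with t htv htS
  have e : fderiv ℂ (fun x => g t x - g t₀ x) x₀ = fderiv ℂ (g t) x₀ - fderiv ℂ (g t₀) x₀ :=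
    fderiv_fun_sub ((hd t htS).differentiableAt hx) ((hd t₀ ht₀).differentiableAt hx)
  rw [dist_eq_norm, ← e]
  have hb : ∀ x ∈ Metric.ball x₀ r, ‖g t x - g t₀ x‖ ≤ ε * r / 4 := by
    intro x hx
    have := hv' t htv x (Metric.ball_subset_closedBall hx)
    simp only [Set.mem_ofPred_eq, dist_eq_norm] at this
    exact this.le
  have := Complex.norm_fderiv_le_div_of_mapsTo_ball (f := fun x => g t x - g t₀ x) (c := x₀)
    (R₁ := r) (R₂ := ε * r / 2) ((hd t htS).sub (hd t₀ ht₀)) (by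
      intro x hx
      rw [Metric.mem_closedBall, dist_eq_norm]
      have h1 := hb x hx
      have h2 := hb x₀ (Metric.mem_ball_self hr)
      exact (norm_sub_le _ _).trans (by linarith)) hr
  refine this.trans_lt ?_
  rw [div_lt_iff₀ hr]
  nlinarith [mul_pos hε hr]

theorem aux_contDiffAt [ProperSpace H] {f : H → ℂ} {U : Set H} {x₀ : H} (hU : U ∈ 𝓝 x₀)
    (hf : DifferentiableOn ℂ f U) : ContDiffAt ℂ 1 f x₀ := by
  rw [← interior_mem_nhds] at hU
  have key : ContDiffOn ℂ 1 f (interior U) := by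
    rw [show (1 : WithTop ℕ∞) = 0 + 1 by rfl, contDiffOn_succ_iff_fderiv_of_isOpen isOpen_interior]
    refine ⟨hf.mono interior_subset, by simp, ?_⟩
    rw [contDiffOn_zero]
    intro x hx
    apply ContinuousAt.continuousWithinAt
    obtain ⟨r, hr, hrU⟩ := Metric.isOpen_iff.1 isOpen_interior x hx
    have hm : ∀ t ∈ Metric.ball (0 : H) (r / 2), ∀ y ∈ Metric.closedBall x (r / 2),
        y + t ∈ interior U := by
      intro t ht y hy
      apply hrU
      rw [Metric.mem_closedBall, dist_eq_norm] at hy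
      rw [mem_ball_zero_iff] at ht
      rw [Metric.mem_ball, dist_eq_norm, show y + t - x = (y - x) + t by abel]
      exact (norm_add_le _ _).trans_lt (by linarith)
    have h := aux_fderiv_continuousAt (g := fun (t : H) (y : H) => f (y + t)) (t₀ := (0 : H))
      (x₀ := x) (r := r / 2) (Metric.ball_mem_nhds (0 : H) (half_pos hr)) (half_pos hr)
      (by
        have h1 : ContinuousOn f (interior U) := hf.continuousOn.mono interior_subset
        refine h1.comp (f := fun p : H × H => p.2 + p.1) (by fun_prop) ?_
        rintro ⟨t, y⟩ ⟨ht, hy⟩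
        exact hm t ht y hy)
      (by
        intro t ht
        refine (hf.mono interior_subset).comp (by fun_prop) ?_
        intro y hy
        exact hm t ht y (Metric.ball_subset_closedBall hy))
    have h2 : (fun t => fderiv ℂ (fun y => f (y + t)) x) = fun t => fderiv ℂ f (x + t) := by
      funext t
      exact fderiv_comp_add_right t
    rw [h2] at h
    have h3 : ContinuousAt (fun y : H => y - x) x := by fun_prop
    have h4 := ContinuousAt.comp (f := fun y : H => y - x) (x := x)
      (g := fun t => fderiv ℂ f (x + t)) (by simpa using h) h3
    refine h4.congr (Eventually.of_forall fun y => ?_)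
    simp
  exact key.contDiffAt hU

theorem aux_integral [ProperSpace H] {g : ℝ → H → ℂ} {a b : ℝ} {x₀ : H} {r : ℝ} (hr : 0 < r)
    (hc : ContinuousOn (Function.uncurry g) (Set.univ ×ˢ Metric.closedBall x₀ r))
    (hd : ∀ t, DifferentiableOn ℂ (g t) (Metric.ball x₀ r)) :
    DifferentiableAt ℂ (fun x => ∫ t in a..b, g t x) x₀ := by
  have hcx : ∀ x ∈ Metric.closedBall x₀ r, Continuous (fun t => g t x) := by
    intro x hx
    rw [← continuousOn_univ]
    exact hc.comp (f := fun t : ℝ => (t, x)) (by fun_prop) (fun t _ => ⟨trivial, hx⟩)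
  obtain ⟨M, hM⟩ := ((isCompact_uIcc (a := a) (b := b)).prod
    (isCompact_closedBall x₀ r)).exists_bound_of_continuousOn
      (hc.mono (Set.prod_mono (Set.subset_univ _) le_rfl))
  have hx₀ : x₀ ∈ Metric.closedBall x₀ r := Metric.mem_closedBall_self hr.le
  have hs : ∀ x ∈ Metric.ball x₀ (r / 2), Metric.ball x (r / 2) ⊆ Metric.ball x₀ r := by
    intro x hx
    apply Metric.ball_subset_ball'
    rw [Metric.mem_ball] at hx
    linarith
  have := intervalIntegral.hasFDerivAt_integral_of_dominated_of_fderiv_le (𝕜 := ℂ)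
    (μ := MeasureTheory.volume) (F := fun x t => g t x)
    (F' := fun x t => fderiv ℂ (g t) x) (x₀ := x₀) (a := a) (b := b)
    (bound := fun _ => 2 * M / (r / 2))
    (Metric.ball_mem_nhds x₀ (half_pos hr))
    (by
      filter_upwards [Metric.closedBall_mem_nhds x₀ hr] with x hx
      exact (hcx x hx).aestronglyMeasurable)
    ((hcx x₀ hx₀).intervalIntegrable _ _)
    (by
      have : Continuous fun t => fderiv ℂ (g t) x₀ := by
        rw [continuous_iff_continuousAt]
        intro t
        exact aux_fderiv_continuousAt univ_mem hr hc (fun t _ => hd t)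
      exact this.aestronglyMeasurable)
    (by
      refine Eventually.of_forall fun t ht x hx => ?_
      refine Complex.norm_fderiv_le_div_of_mapsTo_ball ((hd t).mono (hs x hx)) ?_ (half_pos hr)
      intro y hy
      have ht' := Set.uIoc_subset_uIcc ht
      have h1 := hM (t, y) ⟨ht', Metric.ball_subset_closedBall (hs x hx hy)⟩
      have h2 := hM (t, x) ⟨ht', Metric.ball_subset_closedBall
        (hs x hx (Metric.mem_ball_self (half_pos hr)))⟩
      rw [Metric.mem_closedBall, dist_eq_norm]
      simp only [Function.uncurry] at h1 h2
      exact (norm_sub_le _ _).trans (by linarith))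
    (by simp)
    (by
      refine Eventually.of_forall fun t ht x hx => ?_
      refine ((hd t).differentiableAt ?_).hasFDerivAt
      exact mem_of_superset (Metric.ball_mem_nhds x (half_pos hr)) (hs x hx))
  exact this.differentiableAt

theorem aux_implicit {E : Type*} [NormedAddCommGroup E] [NormedSpace ℂ E] [ProperSpace E]
    {f : ℂ × E → ℂ} {U : Set (ℂ × E)} (hU : U ∈ 𝓝 (0 : ℂ × E))
    (hf : DifferentiableOn ℂ f U) (hf0 : f 0 = 0)
    (hft : deriv (fun t : ℂ => f (t, 0)) 0 ≠ 0) :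
    ∃ A : E → ℂ, A 0 = 0 ∧ ContDiffAt ℂ 1 A 0 ∧ ∀ᶠ z in 𝓝 (0 : E), f (A z, z) = 0 := by
  have : CompleteSpace E := inferInstance
  have h1 : ContDiffAt ℂ 1 f 0 := aux_contDiffAt hU hf
  have h2 : ContDiffAt ℂ 1 (fun p : E × ℂ => f (p.2, p.1)) ((0 : E), (0 : ℂ)) :=
    ContDiffAt.comp (g := f) (f := fun p : E × ℂ => (p.2, p.1)) ((0 : E), (0 : ℂ)) h1
      (by fun_prop)
  set L := fderiv ℂ (fun p : E × ℂ => f (p.2, p.1)) ((0 : E), (0 : ℂ)) ∘L .inr ℂ E ℂ with hL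
  have hL1 : L 1 ≠ 0 := by
    have hd := (h2.differentiableAt one_ne_zero).hasFDerivAt
    have h3 : HasDerivAt (fun t : ℂ => ((0 : E), t)) ((0 : E), (1 : ℂ)) 0 :=
      (hasDerivAt_const _ _).prodMk (hasDerivAt_id _)
    have h4 := HasFDerivAt.comp_hasDerivAt (0 : ℂ) (f := fun t : ℂ => ((0 : E), t)) hd h3
    have h5 := h4.deriv
    have h6 : L 1 = deriv (fun t : ℂ => f (t, 0)) 0 := h5.symm
    rw [h6]; exact hft
  have hinv : L.IsInvertible := by
    refine ⟨ContinuousLinearEquiv.unitsEquivAut ℂ (Units.mk0 (L 1) hL1), ?_⟩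
    ext
    simp
  refine ⟨h2.implicitFunction one_ne_zero hinv, h2.implicitFunction_apply_self one_ne_zero hinv,
    h2.contDiffAt_implicitFunction one_ne_zero hinv, ?_⟩
  filter_upwards [h2.eventually_apply_implicitFunction one_ne_zero hinv] with z hz
  exact hz.trans hf0

theorem aux_exists {E : Type*} [NormedAddCommGroup E] [NormedSpace ℂ E] [ProperSpace E]
    {f : ℂ × E → ℂ} {U : Set (ℂ × E)} (hU : U ∈ 𝓝 (0 : ℂ × E))
    (hf : DifferentiableOn ℂ f U) (hf0 : f 0 = 0)
    (hft : deriv (fun t : ℂ => f (t, 0)) 0 ≠ 0) :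
    ∃ (V : Set E) (W : Set (ℂ × E)) (A : E → ℂ) (B : ℂ × E → ℂ),
      V ∈ 𝓝 (0 : E) ∧ W ∈ 𝓝 (0 : ℂ × E) ∧
      DifferentiableOn ℂ A V ∧ DifferentiableOn ℂ B W ∧
      A 0 = 0 ∧ B 0 ≠ 0 ∧ (∀ p ∈ W, f p = (p.1 - A p.2) * B p) := by
  obtain ⟨A, hA0, hA, hfA⟩ := aux_implicit hU hf hf0 hft
  obtain ⟨R, hR, hRU⟩ := Metric.mem_nhds_iff.1 hU
  set r := R / 2 with hr_def
  have hr : 0 < r := half_pos hR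
  have e1 : ∀ᶠ z in 𝓝 (0 : E), DifferentiableAt ℂ A z :=
    (hA.eventually (by simp)).mono fun z hz => hz.differentiableAt one_ne_zero
  have e2 : ∀ᶠ z in 𝓝 (0 : E), A z ∈ Metric.ball (0 : ℂ) r :=
    hA.continuousAt.eventually_mem (by rw [hA0]; exact Metric.ball_mem_nhds _ hr)
  obtain ⟨δ, hδ, hδ'⟩ := Metric.eventually_nhds_iff_ball.1 (e1.and (e2.and hfA))
  have hopen : IsOpen (Metric.ball (0 : ℂ) r ×ˢ Metric.ball (0 : E) (min δ r)) :=
    Metric.isOpen_ball.prod Metric.isOpen_ball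
  set W := Metric.ball (0 : ℂ) r ×ˢ Metric.ball (0 : E) (min δ r) with hW
  have hUm : ∀ s ∈ Metric.closedBall (0 : ℂ) r, ∀ z ∈ Metric.ball (0 : E) (min δ r),
      (s, z) ∈ Metric.ball (0 : ℂ × E) R := by
    intro s hs z hz
    rw [mem_closedBall_zero_iff] at hs
    rw [mem_ball_zero_iff] at hz ⊢
    rw [Prod.norm_mk]
    have := hz.trans_le (min_le_right _ _)
    exact max_lt (by linarith) (by linarith)
  have hfb : DifferentiableOn ℂ f (Metric.ball (0 : ℂ × E) R) := hf.mono hRU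
  have hzm : ∀ z ∈ Metric.ball (0 : E) (min δ r), z ∈ Metric.ball (0 : E) δ :=
    fun z hz => Metric.ball_subset_ball (min_le_left _ _) hz
  have hsne : ∀ (θ : ℝ) (w : ℂ), w ∈ Metric.ball (0 : ℂ) r → circleMap 0 r θ - w ≠ 0 := by
    intro θ w hw h
    exact circleMap_ne_mem_ball hw θ (sub_eq_zero.1 h)
  have hcm : ∀ θ, circleMap 0 r θ ∈ Metric.closedBall (0 : ℂ) r :=
    fun θ => circleMap_mem_closedBall 0 hr.le θ
  refine ⟨Metric.ball 0 δ, W, A, fun p => dslope (fun s => f (s, p.2)) (A p.2) p.1,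
    Metric.ball_mem_nhds _ hδ, ?_, ?_, ?_, hA0, ?_, ?_⟩
  · refine hopen.mem_nhds ?_
    constructor
    · exact Metric.mem_ball_self hr
    · exact Metric.mem_ball_self (lt_min hδ hr)
  · exact fun z hz => (hδ' z hz).1.differentiableWithinAt
  · set g : ℝ → ℂ × E → ℂ := fun θ p => deriv (circleMap 0 r) θ *
      ((circleMap 0 r θ - p.1)⁻¹ * ((circleMap 0 r θ - A p.2)⁻¹ * f (circleMap 0 r θ, p.2))) with hg
    have hrep : ∀ p ∈ W, dslope (fun s => f (s, p.2)) (A p.2) p.1 =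
        (2 * Real.pi * Complex.I : ℂ)⁻¹ * ∫ θ in (0 : ℝ)..2 * Real.pi, g θ p := by
      rintro ⟨t, z⟩ ⟨ht, hz⟩
      have hz' := hδ' z (hzm z hz)
      have hdo : DifferentiableOn ℂ (fun s => f (s, z)) (Metric.closedBall 0 r) :=
        hfb.comp (f := fun s : ℂ => (s, z)) (by fun_prop) (fun s hs => hUm s hs z hz)
      have hds : DifferentiableOn ℂ (dslope (fun s => f (s, z)) (A z)) (Metric.closedBall 0 r) := by
        rw [Complex.differentiableOn_dslope]
        · exact hdo
        · exact mem_of_superset (Metric.isOpen_ball.mem_nhds hz'.2.1) Metric.ball_subset_closedBall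
      have hC := hds.circleIntegral_sub_inv_smul ht
      have hne : (2 * Real.pi * Complex.I : ℂ) ≠ 0 := by
        simp [Real.pi_ne_zero]
      rw [eq_inv_mul_iff_mul_eq₀ hne]
      rw [smul_eq_mul] at hC
      dsimp only at hC ⊢
      rw [← hC, circleIntegral]
      refine intervalIntegral.integral_congr fun θ _ => ?_
      have h1 : circleMap 0 r θ ≠ A z := circleMap_ne_mem_ball hz'.2.1 θ
      simp only [hg, smul_eq_mul]
      rw [dslope_of_ne _ h1, slope_def_field, hz'.2.2]
      ring
    have hgd : ∀ θ, DifferentiableOn ℂ (g θ) W := by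
      rintro θ ⟨t, z⟩ ⟨ht, hz⟩
      have hz' := hδ' z (hzm z hz)
      apply DifferentiableAt.differentiableWithinAt
      have i1 : DifferentiableAt ℂ (fun p : ℂ × E => A p.2) (t, z) :=
        DifferentiableAt.comp (g := A) (f := Prod.snd) (t, z) hz'.1 differentiableAt_snd
      have i2 : DifferentiableAt ℂ (fun p : ℂ × E => f (circleMap 0 r θ, p.2)) (t, z) := by
        refine DifferentiableAt.comp (g := f) (f := fun p : ℂ × E => (circleMap 0 r θ, p.2))
          (t, z) ?_ (by fun_prop)
        exact hfb.differentiableAt (Metric.isOpen_ball.mem_nhds (hUm _ (hcm θ) z hz))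
      have i3 : DifferentiableAt ℂ (fun p : ℂ × E => (circleMap 0 r θ - p.1)⁻¹) (t, z) :=
        DifferentiableAt.fun_inv (by fun_prop) (hsne θ t ht)
      have i4 : DifferentiableAt ℂ (fun p : ℂ × E => (circleMap 0 r θ - A p.2)⁻¹) (t, z) :=
        DifferentiableAt.fun_inv (i1.const_sub _) (hsne θ _ hz'.2.1)
      exact (i3.mul (i4.mul i2)).const_mul _
    have hgc : ContinuousOn (Function.uncurry g) (Set.univ ×ˢ W) := by
      have c0 : Continuous (fun q : ℝ × ℂ × E => circleMap 0 r q.1) :=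
        (continuous_circleMap 0 r).comp continuous_fst
      have c1 : ContinuousOn (fun q : ℝ × ℂ × E => A q.2.2) (Set.univ ×ˢ W) := by
        have : ContinuousOn A (Metric.ball 0 δ) :=
          fun z hz => (hδ' z hz).1.continuousAt.continuousWithinAt
        refine this.comp (f := fun q : ℝ × ℂ × E => q.2.2) (by fun_prop) ?_
        rintro ⟨θ, t, z⟩ ⟨-, ht, hz⟩
        exact hzm z hz
      have c2 : ContinuousOn (fun q : ℝ × ℂ × E => f (circleMap 0 r q.1, q.2.2))
          (Set.univ ×ˢ W) := by
        refine hfb.continuousOn.comp (f := fun q : ℝ × ℂ × E => (circleMap 0 r q.1, q.2.2))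
          (by fun_prop) ?_
        rintro ⟨θ, t, z⟩ ⟨-, ht, hz⟩
        exact hUm _ (hcm θ) z hz
      have c3 : ContinuousOn (fun q : ℝ × ℂ × E => (circleMap 0 r q.1 - q.2.1)⁻¹)
          (Set.univ ×ˢ W) := by
        refine ContinuousOn.inv₀ (by fun_prop) ?_
        rintro ⟨θ, t, z⟩ ⟨-, ht, hz⟩
        exact hsne θ t ht
      have c4 : ContinuousOn (fun q : ℝ × ℂ × E => (circleMap 0 r q.1 - A q.2.2)⁻¹)
          (Set.univ ×ˢ W) := by
        refine ContinuousOn.inv₀ (c0.continuousOn.sub c1) ?_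
        rintro ⟨θ, t, z⟩ ⟨-, ht, hz⟩
        exact hsne θ _ (hδ' z (hzm z hz)).2.1
      have c5 : Continuous (fun q : ℝ × ℂ × E => deriv (circleMap 0 r) q.1) := by
        simp only [deriv_circleMap]
        fun_prop
      exact c5.continuousOn.mul (c3.mul (c4.mul c2))
    intro p hp
    apply DifferentiableAt.differentiableWithinAt
    obtain ⟨ε, hε, hεW⟩ := Metric.nhds_basis_closedBall.mem_iff.1 (hopen.mem_nhds hp)
    have hI : DifferentiableAt ℂ (fun p => ∫ θ in (0 : ℝ)..2 * Real.pi, g θ p) p :=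
      aux_integral hε (hgc.mono (Set.prod_mono le_rfl hεW))
        (fun θ => (hgd θ).mono (Metric.ball_subset_closedBall.trans hεW))
    refine (hI.const_mul ((2 * Real.pi * Complex.I : ℂ)⁻¹)).congr_of_eventuallyEq ?_
    filter_upwards [hopen.mem_nhds hp] with q hq
    exact hrep q hq
  · simpa [hA0] using hft
  · rintro ⟨t, z⟩ ⟨ht, hz⟩
    have := sub_smul_dslope (fun s => f (s, z)) (A z) t
    simp only [smul_eq_mul] at this
    dsimp only
    rw [this, (hδ' z (hzm z hz)).2.2, sub_zero]

theorem aux_unique {E : Type*} [NormedAddCommGroup E] [NormedSpace ℂ E]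
    {f : ℂ × E → ℂ} {V V' : Set E} {W W' : Set (ℂ × E)} {A A' : E → ℂ} {B B' : ℂ × E → ℂ}
    (hV : V ∈ 𝓝 (0 : E)) (hW : W ∈ 𝓝 (0 : ℂ × E))
    (hA : DifferentiableOn ℂ A V) (hB : DifferentiableOn ℂ B W)
    (hB0 : B 0 ≠ 0) (h : ∀ p ∈ W, f p = (p.1 - A p.2) * B p)
    (hV' : V' ∈ 𝓝 (0 : E)) (hW' : W' ∈ 𝓝 (0 : ℂ × E))
    (hA' : DifferentiableOn ℂ A' V') (hB' : DifferentiableOn ℂ B' W')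
    (hA0' : A' 0 = 0) (h' : ∀ p ∈ W', f p = (p.1 - A' p.2) * B' p) :
    A =ᶠ[𝓝 (0 : E)] A' ∧ B =ᶠ[𝓝 (0 : ℂ × E)] B' := by
  have hcA' : ContinuousAt A' 0 := (hA'.differentiableAt hV').continuousAt
  have hcB : ContinuousAt B 0 := (hB.differentiableAt hW).continuousAt
  have hAA : A =ᶠ[𝓝 (0 : E)] A' := by
    have ht : Tendsto (fun z => (A' z, z)) (𝓝 (0 : E)) (𝓝 (0 : ℂ × E)) := by
      have : ContinuousAt (fun z => (A' z, z)) (0 : E) := hcA'.prodMk continuousAt_id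
      have h2 := this.tendsto
      rw [hA0'] at h2
      exact h2
    have hB1 : ∀ᶠ p in 𝓝 (0 : ℂ × E), B p ≠ 0 := hcB.eventually_ne hB0
    filter_upwards [ht.eventually hB1, ht.eventually hW, ht.eventually hW'] with z h1 h2 h3
    have e := (h _ h2).symm.trans (h' _ h3)
    simp only [sub_self, zero_mul, mul_eq_zero] at e
    rcases e with e | e
    · exact (sub_eq_zero.1 e).symm
    · exact absurd e h1
  refine ⟨hAA, ?_⟩
  have hs : Tendsto (Prod.snd : ℂ × E → E) (𝓝 0) (𝓝 0) := continuous_snd.tendsto 0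
  filter_upwards [eventually_eventually_nhds.2 (hs.eventually hAA),
    eventually_eventually_nhds.2 hW, eventually_eventually_nhds.2 hW'] with p h1 h2 h3
  obtain ⟨t, z⟩ := p
  have hi : ContinuousAt (fun s : ℂ => (s, z)) t := by fun_prop
  have k1 : ContinuousAt (fun s => B (s, z)) t :=
    ContinuousAt.comp (g := B) (f := fun s : ℂ => (s, z)) (hB.differentiableAt h2).continuousAt hi
  have k2 : ContinuousAt (fun s => B' (s, z)) t :=
    ContinuousAt.comp (g := B') (f := fun s : ℂ => (s, z))
      (hB'.differentiableAt h3).continuousAt hi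
  have hne : ∀ᶠ s in 𝓝[≠] t, s ≠ A z := by
    by_cases htA : t = A z
    · rw [← htA]; exact self_mem_nhdsWithin
    · exact (continuousAt_id.eventually_ne htA).filter_mono nhdsWithin_le_nhds
  have hev : (fun s => B (s, z)) =ᶠ[𝓝[≠] t] fun s => B' (s, z) := by
    filter_upwards [hne, (hi.eventually h1).filter_mono nhdsWithin_le_nhds,
      (hi.eventually h2).filter_mono nhdsWithin_le_nhds,
      (hi.eventually h3).filter_mono nhdsWithin_le_nhds] with s g1 g2 g3 g4
    have e := (h _ g3).symm.trans (h' _ g4)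
    have g2' : A z = A' z := g2
    simp only [← g2'] at e
    exact mul_left_cancel₀ (sub_ne_zero.2 g1) e
  exact tendsto_nhds_unique (k1.tendsto.mono_left nhdsWithin_le_nhds)
    ((k2.tendsto.mono_left nhdsWithin_le_nhds).congr' hev.symm)

end helpers

/-- Weierstrass preparation, simple-zero case: if `f(t,z)` is holomorphic
near `(0,0) ∈ ℂ × ℂⁿ` with `f(0,0) = 0` and `∂f/∂t(0,0) ≠ 0`, then `f(t,z) = (t - A(z)) B(t,z)`
near `(0,0)` with `A`, `B` holomorphic, `A(0) = 0`, `B(0,0) ≠ 0`, and the factorization is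
unique in the sense that any two such pairs agree near `0` resp. `(0,0)`. -/
theorem stmt_19 (n : ℕ) (hn : 1 ≤ n)
    (f : ℂ × EuclideanSpace ℂ (Fin n) → ℂ)
    (U : Set (ℂ × EuclideanSpace ℂ (Fin n))) (hU : U ∈ 𝓝 (0 : ℂ × EuclideanSpace ℂ (Fin n)))
    (hf : DifferentiableOn ℂ f U)
    (hf0 : f 0 = 0)
    (hft : deriv (fun t : ℂ => f (t, 0)) 0 ≠ 0) :
    ∃ (V : Set (EuclideanSpace ℂ (Fin n))) (W : Set (ℂ × EuclideanSpace ℂ (Fin n)))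
      (A : EuclideanSpace ℂ (Fin n) → ℂ) (B : ℂ × EuclideanSpace ℂ (Fin n) → ℂ),
      V ∈ 𝓝 (0 : EuclideanSpace ℂ (Fin n)) ∧
      W ∈ 𝓝 (0 : ℂ × EuclideanSpace ℂ (Fin n)) ∧
      DifferentiableOn ℂ A V ∧ DifferentiableOn ℂ B W ∧
      A 0 = 0 ∧ B 0 ≠ 0 ∧
      (∀ p ∈ W, f p = (p.1 - A p.2) * B p) ∧
      (∀ (V' : Set (EuclideanSpace ℂ (Fin n))) (W' : Set (ℂ × EuclideanSpace ℂ (Fin n)))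
        (A' : EuclideanSpace ℂ (Fin n) → ℂ) (B' : ℂ × EuclideanSpace ℂ (Fin n) → ℂ),
        V' ∈ 𝓝 (0 : EuclideanSpace ℂ (Fin n)) →
        W' ∈ 𝓝 (0 : ℂ × EuclideanSpace ℂ (Fin n)) →
        DifferentiableOn ℂ A' V' → DifferentiableOn ℂ B' W' →
        A' 0 = 0 → B' 0 ≠ 0 →
        (∀ p ∈ W', f p = (p.1 - A' p.2) * B' p) →
        (A =ᶠ[𝓝 (0 : EuclideanSpace ℂ (Fin n))] A' ∧
          B =ᶠ[𝓝 (0 : ℂ × EuclideanSpace ℂ (Fin n))] B')) := by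
  obtain ⟨V, W, A, B, hV, hW, hA, hB, hA0, hB0, h⟩ := aux_exists hU hf hf0 hft
  refine ⟨V, W, A, B, hV, hW, hA, hB, hA0, hB0, h, ?_⟩
  intro V' W' A' B' hV' hW' hA' hB' hA0' _ h'
  exact aux_unique hV hW hA hB hB0 h hV' hW' hA' hB' hA0' h'
end
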